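/- arXiv:math/0404299 — 8 statements merged into one kernel-verified Lean document; each statement's English description precedes it below -/
import Mathlib

section
/- Fix β>0 and ε>0. A pair (h₀,−l) with l>0 belongs to the neutral set R(β,ε) if and only if 0 < h̄_{β,ε}(l) < h₀ and m^{CW}(β, h₀ − h̄_{β,ε}(l)) = sinh(2l)/sinh(2βε). Moreover the set of such pairs is the graph of a continuous strictly increasing function h₀ ↦ l_{β,ε}(h₀) which is a bijection from the interval (a(β,ε),∞) onto the interval (l_min, βε), where l_min = (1/2)·arcsinh( sinh(2βε)·m^{CW}(β,0+) ) and a(β,ε) = h̄_{β,ε}(l_min). -/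
open Real Filter MeasureTheory
open scoped Classical BigOperators

noncomputable section

/-- Map a Boolean to a ±1 spin value. -/
def spin (b : Bool) : ℝ := if b then 1 else -1

/-- Hamiltonian (with sign absorbed) of the Morita approximant measure. -/
def morH (N : ℕ) (β ε h₀ lam : ℝ) (σ η : Fin N → Bool) : ℝ :=
  β / (2 * N) * (∑ i, spin (σ i)) ^ 2
    + β * ∑ i, (ε * spin (η i) + h₀) * spin (σ i)
    + lam * ∑ i, spin (η i)

/-- Partition function of the Morita approximant measure. -/
def morZ (N : ℕ) (β ε h₀ lam : ℝ) : ℝ :=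
  ∑ σ : Fin N → Bool, ∑ η : Fin N → Bool, Real.exp (morH N β ε h₀ lam σ η)

/-- The Morita approximant measure on pairs of configurations. -/
def morK (N : ℕ) (β ε h₀ lam : ℝ) (σ η : Fin N → Bool) : ℝ :=
  Real.exp (morH N β ε h₀ lam σ η) / morZ N β ε h₀ lam

/-- Probability under the Morita approximant measure that the first `N₀`
random-field variables agree with `ηbar`. -/
def etaCylProb (N₀ N : ℕ) (β ε h₀ lam : ℝ) (ηbar : Fin N₀ → Bool) : ℝ :=
  ∑ σ : Fin N → Bool, ∑ η : Fin N → Bool,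
    if ∀ (i : Fin N₀) (h : (i : ℕ) < N), η ⟨i, h⟩ = ηbar i
    then morK N β ε h₀ lam σ η else 0

/-- `(h₀, lam)` is neutral: the η-marginal of the Morita approximant measures
converges weakly to the symmetric i.i.d. field distribution. -/
def IsNeutral (β ε h₀ lam : ℝ) : Prop :=
  ∀ (N₀ : ℕ) (ηbar : Fin N₀ → Bool),
    Tendsto (fun N => etaCylProb N₀ N β ε h₀ lam ηbar) atTop (nhds ((2 : ℝ)⁻¹ ^ N₀))

/-- The field-shift function `h̄_{β,ε}(λ)`. -/
def hbar (β ε lam : ℝ) : ℝ :=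
  1 / (2 * β) * Real.log (Real.cosh (lam + β * ε) / Real.cosh (lam - β * ε))

/-- The single-site joint kernel `π_{λ;β,ε,h₀}[m](σ₁,η₁)`. -/
def piK (β ε h₀ lam m : ℝ) (s t : Bool) : ℝ :=
  Real.exp (β * (m + ε * spin t + h₀) * spin s + lam * spin t) /
    (2 * (Real.cosh (β * (m + ε + h₀)) * Real.exp lam
        + Real.cosh (β * (m - ε + h₀)) * Real.exp (-lam)))

/-- Probability under the Morita approximant measure that the first `N₀` spins and
random fields agree with `(σbar, ηbar)`. -/
def pairCylProb (N₀ N : ℕ) (β ε h₀ lam : ℝ) (σbar ηbar : Fin N₀ → Bool) : ℝ :=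
  ∑ σ : Fin N → Bool, ∑ η : Fin N → Bool,
    if ∀ (i : Fin N₀) (h : (i : ℕ) < N), σ ⟨i, h⟩ = σbar i ∧ η ⟨i, h⟩ = ηbar i
    then morK N β ε h₀ lam σ η else 0


lemma ax_sinh_ratio {p q : ℝ} (hp : 0 < p) (hpq : p < q) : q * Real.sinh p < p * Real.sinh q := by
  obtain ⟨x1, hx1, h1⟩ := exists_deriv_eq_slope Real.sinh hp Real.continuous_sinh.continuousOn
    Real.differentiable_sinh.differentiableOn
  obtain ⟨x2, hx2, h2⟩ := exists_deriv_eq_slope Real.sinh hpq Real.continuous_sinh.continuousOn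
    Real.differentiable_sinh.differentiableOn
  rw [Real.deriv_sinh] at h1 h2
  have hc : Real.cosh x1 < Real.cosh x2 := by
    rw [Real.cosh_lt_cosh, abs_of_pos hx1.1, abs_of_pos (by linarith [hx2.1])]
    linarith [hx1.2, hx2.1]
  rw [h1, h2, Real.sinh_zero, sub_zero, sub_zero, div_lt_div_iff₀ hp (by linarith)] at hc
  nlinarith

lemma ax_tanh_ratio {u v : ℝ} (hu : 0 < u) (huv : u < v) :
    Real.tanh v * u < Real.tanh u * v := by
  have h := ax_sinh_ratio (p := v - u) (q := v + u) (by linarith) (by linarith)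
  rw [Real.sinh_add, Real.sinh_sub] at h
  rw [Real.tanh_eq_sinh_div_cosh, Real.tanh_eq_sinh_div_cosh, div_mul_eq_mul_div,
    div_mul_eq_mul_div, div_lt_div_iff₀ (Real.cosh_pos _) (Real.cosh_pos _)]
  nlinarith

lemma ax_tanh_strictMono : StrictMono Real.tanh := by
  intro x y hxy
  rw [Real.tanh_eq_sinh_div_cosh, Real.tanh_eq_sinh_div_cosh,
    div_lt_div_iff₀ (Real.cosh_pos _) (Real.cosh_pos _)]
  have := Real.sinh_pos_iff.2 (sub_pos.2 hxy)
  rw [Real.sinh_sub] at this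
  nlinarith

lemma ax_tanh_bd (x : ℝ) : -1 < Real.tanh x ∧ Real.tanh x < 1 := by
  rw [Real.tanh_eq_sinh_div_cosh, lt_div_iff₀ (Real.cosh_pos _), div_lt_one (Real.cosh_pos _)]
  rw [Real.sinh_eq, Real.cosh_eq]
  constructor <;> linarith [Real.exp_pos x, Real.exp_pos (-x)]

lemma ax_tanh_cont : Continuous Real.tanh := by
  have : Real.tanh = fun x => Real.sinh x / Real.cosh x := by
    ext x; exact Real.tanh_eq_sinh_div_cosh x
  rw [this]
  exact Real.continuous_sinh.div Real.continuous_cosh (fun x => (Real.cosh_pos x).ne')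

lemma ax_cw_mono {β h1 h2 m1 m2 : ℝ} (hβ : 0 < β) (h1n : 0 ≤ h1) (hh : h1 ≤ h2)
    (p1 : 0 < m1) (p2 : 0 < m2) (e1 : m1 = Real.tanh (β * (m1 + h1)))
    (e2 : m2 = Real.tanh (β * (m2 + h2))) : m1 ≤ m2 := by
  by_contra hlt
  push Not at hlt
  have hu : β * (m2 + h2) < β * (m1 + h1) := by
    by_contra hcon
    push Not at hcon
    have := ax_tanh_strictMono.monotone hcon
    linarith
  have := ax_tanh_ratio (mul_pos hβ (by linarith)) hu
  rw [← e1, ← e2] at this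
  have h3 : m1 * (m2 + h2) < m2 * (m1 + h1) := by
    by_contra hc
    push Not at hc
    nlinarith [mul_le_mul_of_nonneg_left hc hβ.le]
  nlinarith [mul_nonneg p2.le (sub_nonneg.2 hh), mul_nonneg (sub_nonneg.2 hlt.le) h1n,
    mul_nonneg p1.le (sub_nonneg.2 hh)]

lemma ax_cw_unique {β h m1 m2 : ℝ} (hβ : 0 < β) (hn : 0 ≤ h)
    (p1 : 0 < m1) (p2 : 0 < m2) (e1 : m1 = Real.tanh (β * (m1 + h)))
    (e2 : m2 = Real.tanh (β * (m2 + h))) : m1 = m2 :=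
  le_antisymm (ax_cw_mono hβ hn le_rfl p1 p2 e1 e2) (ax_cw_mono hβ hn le_rfl p2 p1 e2 e1)

lemma ax_gap (c : ℝ → ℝ) (x0 : ℝ) (hc : Continuous c) (hpos : ∀ x, 0 < c x)
    (hmax : ∀ x, x ≠ x0 → c x < c x0) (hlim : Tendsto c (cocompact ℝ) (nhds 0))
    (δ : ℝ) (hδ : 0 < δ) : ∃ q, 0 < q ∧ q < c x0 ∧ ∀ x, δ ≤ |x - x0| → c x ≤ q := by
  have h1 : ∀ᶠ x in cocompact ℝ, c x < c x0 / 2 :=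
    hlim.eventually_lt_const (half_pos (hpos x0))
  obtain ⟨K, hK, hKs⟩ := mem_cocompact.1 h1
  have hS : IsCompact (K ∩ {x | δ ≤ |x - x0|}) :=
    hK.inter_right (isClosed_le continuous_const (by fun_prop))
  rcases (K ∩ {x | δ ≤ |x - x0|}).eq_empty_or_nonempty with he | hne
  · refine ⟨c x0 / 2, half_pos (hpos x0), half_lt_self (hpos x0), fun x hx => ?_⟩
    have : x ∈ Kᶜ := fun hxK => by
      have : x ∈ K ∩ {x | δ ≤ |x - x0|} := ⟨hxK, hx⟩
      rw [he] at this; exact this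
    exact (hKs this).le
  · obtain ⟨z, hz, hzm⟩ := hS.exists_isMaxOn hne hc.continuousOn
    refine ⟨max (c x0 / 2) (c z), lt_max_of_lt_left (half_pos (hpos x0)),
      max_lt (half_lt_self (hpos x0)) (hmax z ?_), fun x hx => ?_⟩
    · rintro rfl
      have := hz.2
      simp at this; linarith
    · by_cases hxK : x ∈ K
      · exact (hzm (a := x) ⟨hxK, hx⟩).trans (le_max_right _ _)
      · exact (hKs hxK).le.trans (le_max_left _ _)

lemma ax_pow_int (c : ℝ → ℝ) (M : ℝ) (hc : Continuous c) (hpos : ∀ x, 0 < c x)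
    (hM : ∀ x, c x ≤ M) (hcI : Integrable c) (n : ℕ) : Integrable (fun x => c x ^ (n+1)) := by
  refine (hcI.const_mul (M^n)).mono' (by fun_prop) (Eventually.of_forall fun x => ?_)
  rw [Real.norm_of_nonneg (by have := hpos x; positivity), pow_succ]
  exact mul_le_mul_of_nonneg_right (pow_le_pow_left₀ (hpos x).le (hM x) n) (hpos x).le

lemma ax_laplace (c g : ℝ → ℝ) (x0 G : ℝ) (hc : Continuous c) (hpos : ∀ x, 0 < c x)
    (hcI : Integrable c)
    (hmax : ∀ x, x ≠ x0 → c x < c x0) (hlim : Tendsto c (cocompact ℝ) (nhds 0))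
    (hg : Continuous g) (hgb : ∀ x, |g x| ≤ G) :
    Tendsto (fun N : ℕ => (∫ x, g x * c x ^ N) / ∫ x, c x ^ N) atTop (nhds (g x0)) := by
  have hM : ∀ x, c x ≤ c x0 := fun x => by
    rcases eq_or_ne x x0 with rfl | h
    · exact le_rfl
    · exact (hmax x h).le
  have hI := ax_pow_int c (c x0) hc hpos hM hcI
  have hG : 0 ≤ G := (abs_nonneg _).trans (hgb 0)
  rw [← tendsto_add_atTop_iff_nat 1, Metric.tendsto_atTop]
  intro e he
  obtain ⟨δ, hδ, hδg⟩ := Metric.continuous_iff.1 hg x0 (e/2) (half_pos he)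
  obtain ⟨q, hq0, hq1, hq⟩ := ax_gap c x0 hc hpos hmax hlim δ hδ
  obtain ⟨r, hqr, hr⟩ := exists_between hq1
  have hr0 : 0 < r := hq0.trans hqr
  obtain ⟨ρ, hρ, hρc⟩ := Metric.continuous_iff.1 hc x0 (c x0 - r) (by linarith)
  have hlow : ∀ n : ℕ, 2 * ρ * r ^ (n+1) ≤ ∫ x, c x ^ (n+1) := by
    intro n
    calc 2 * ρ * r ^ (n+1) = ∫ x in Metric.ball x0 ρ, r ^ (n+1) := by
          rw [setIntegral_const, Real.ball_eq_Ioo, Measure.real, Real.volume_Ioo,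
            ENNReal.toReal_ofReal (by linarith), smul_eq_mul]
          ring
      _ ≤ ∫ x in Metric.ball x0 ρ, c x ^ (n+1) := by
          refine setIntegral_mono_on (integrableOn_const measure_ball_lt_top.ne) (hI n).integrableOn
            measurableSet_ball (fun x hx => ?_)
          have := hρc x hx
          rw [Real.dist_eq, abs_lt] at this
          exact pow_le_pow_left₀ hr0.le (by linarith) _
      _ ≤ ∫ x, c x ^ (n+1) := setIntegral_le_integral (hI n)
          (Eventually.of_forall fun x => by have := hpos x; positivity)
  have hpt : ∀ (n : ℕ) (x : ℝ), |(g x - g x0) * c x ^ (n+1)| ≤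
      e/2 * c x ^ (n+1) + 2 * G * q ^ n * c x := by
    intro n x
    have hcx := hpos x
    rw [abs_mul, abs_of_pos (pow_pos hcx (n+1))]
    by_cases hx : |x - x0| < δ
    · have := hδg x hx
      rw [Real.dist_eq] at this
      have h2 : 0 ≤ 2 * G * q ^ n * c x := by positivity
      nlinarith [mul_le_mul_of_nonneg_right this.le (pow_pos hcx (n+1)).le]
    · push Not at hx
      have h1 : |g x - g x0| ≤ 2 * G := by
        have := abs_sub (g x) (g x0)
        linarith [hgb x, hgb x0]
      have h2 : c x ^ (n+1) ≤ q ^ n * c x := by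
        rw [pow_succ]
        exact mul_le_mul_of_nonneg_right (pow_le_pow_left₀ hcx.le (hq x hx) n) hcx.le
      have h3 : 0 ≤ e/2 * c x ^ (n+1) := by positivity
      calc |g x - g x0| * c x ^ (n+1) ≤ (2 * G) * (q ^ n * c x) := by gcongr
        _ ≤ _ := by linarith
  have hgI : ∀ n : ℕ, Integrable (fun x => g x * c x ^ (n+1)) := fun n =>
    (hI n).bdd_mul (c := G) (by fun_prop) (Eventually.of_forall fun x => hgb x)
  have hlim2 : Tendsto (fun n : ℕ => (2 * G * ∫ x, c x) / (2 * ρ * r) * (q/r)^n) atTop (nhds 0) := by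
    have := (tendsto_pow_atTop_nhds_zero_of_lt_one (div_nonneg hq0.le hr0.le)
      ((div_lt_one hr0).2 hqr)).const_mul ((2 * G * ∫ x, c x) / (2 * ρ * r))
    simpa using this
  obtain ⟨n0, hn0⟩ := eventually_atTop.1 (hlim2.eventually_lt_const (half_pos he))
  refine ⟨n0, fun n hn => ?_⟩
  have hZ : 0 < ∫ x, c x ^ (n+1) := lt_of_lt_of_le (by positivity) (hlow n)
  rw [Real.dist_eq]
  have heq : (∫ x, g x * c x ^ (n+1)) / (∫ x, c x ^ (n+1)) - g x0
      = (∫ x, (g x - g x0) * c x ^ (n+1)) / (∫ x, c x ^ (n+1)) := by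
    have : ∫ x, (g x - g x0) * c x ^ (n+1)
        = (∫ x, g x * c x ^ (n+1)) - g x0 * ∫ x, c x ^ (n+1) := by
      rw [← integral_const_mul, ← integral_sub (hgI n) ((hI n).const_mul _)]
      congr 1; ext x; ring
    rw [this]; field_simp
  rw [heq, abs_div, abs_of_pos hZ, div_lt_iff₀ hZ]
  have h1 : |∫ x, (g x - g x0) * c x ^ (n+1)| ≤ e/2 * (∫ x, c x ^ (n+1)) + 2 * G * q ^ n * ∫ x, c x := by
    rw [← integral_const_mul, ← integral_const_mul,
      ← integral_add ((hI n).const_mul _) (hcI.const_mul _)]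
    have hb : Integrable (fun x => e/2 * c x ^ (n+1) + 2 * G * q ^ n * c x) :=
      ((hI n).const_mul _).add (hcI.const_mul _)
    exact norm_integral_le_of_norm_le (f := fun x => (g x - g x0) * c x ^ (n+1)) hb (Eventually.of_forall fun x => hpt n x)
  have h2 := hn0 n hn
  have h3 : 2 * G * q ^ n * (∫ x, c x) < e / 2 * ∫ x, c x ^ (n+1) := by
    have h4 : 2 * G * q ^ n * (∫ x, c x) =
        ((2 * G * ∫ x, c x) / (2 * ρ * r) * (q/r)^n) * (2 * ρ * r ^ (n+1)) := by
      rw [div_pow, pow_succ]; field_simp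
    rw [h4]
    exact (mul_lt_mul_of_pos_right h2 (by positivity)).trans_le
      (mul_le_mul_of_nonneg_left (hlow n) (by linarith))
  linarith

lemma ax_hs (b a d : ℝ) (hb : 0 < b) :
    Integrable (fun x : ℝ => Real.exp (-b * x ^ 2 + a * x + d)) ∧
    ∫ x : ℝ, Real.exp (-b * x ^ 2 + a * x + d) = √(π / b) * Real.exp (a ^ 2 / (4 * b) + d) := by
  have h : (fun x : ℝ => Real.exp (-b * x ^ 2 + a * x + d)) =
      fun x => Real.exp (-b * (x - a / (2 * b)) ^ 2) * Real.exp (a ^ 2 / (4 * b) + d) := by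
    ext x
    rw [← Real.exp_add]
    congr 1
    field_simp
    ring
  rw [h]
  constructor
  · exact ((integrable_exp_neg_mul_sq hb).comp_sub_right (a / (2 * b))).mul_const _
  · rw [integral_mul_const, integral_sub_right_eq_self (fun x => Real.exp (-b * x ^ 2)),
      integral_gaussian]

lemma ax_quad_lim (b a d : ℝ) (hb : 0 < b) :
    Tendsto (fun x : ℝ => Real.exp (-b * x ^ 2 + a * x + d)) (cocompact ℝ) (nhds 0) := by
  apply Real.tendsto_exp_atBot.comp
  have h1 : Tendsto (fun x : ℝ => |x|) (cocompact ℝ) atTop := tendsto_norm_cocompact_atTop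
  have h2 : Tendsto (fun t : ℝ => t * (b * t - |a|) - d) atTop atTop := by
    apply tendsto_atTop_add_const_right
    apply Tendsto.atTop_mul_atTop₀ tendsto_id
    apply tendsto_atTop_add_const_right
    exact tendsto_id.const_mul_atTop hb
  have h3 := tendsto_neg_atTop_atBot.comp (h2.comp h1)
  refine tendsto_atBot_mono (fun x => ?_) h3
  simp only [Function.comp]
  have : a * x ≤ |a| * |x| := by rw [← abs_mul]; exact le_abs_self _
  nlinarith [sq_abs x]

def axk (β ε h₀ lam x : ℝ) (s t : Bool) : ℝ :=
  Real.exp (-(β / 2) * x ^ 2 + (β * spin s) * x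
    + (β * (ε * spin t + h₀) * spin s + lam * spin t))

def axw (β ε h₀ lam x : ℝ) (t : Bool) : ℝ := ∑ s, axk β ε h₀ lam x s t

def axc (β ε h₀ lam x : ℝ) : ℝ := ∑ t, axw β ε h₀ lam x t

lemma axw_pos (β ε h₀ lam x : ℝ) (t : Bool) : 0 < axw β ε h₀ lam x t :=
  Finset.sum_pos (fun _ _ => Real.exp_pos _) ⟨true, Finset.mem_univ _⟩

lemma axc_pos (β ε h₀ lam x : ℝ) : 0 < axc β ε h₀ lam x :=
  Finset.sum_pos (fun _ _ => axw_pos _ _ _ _ _ _) ⟨true, Finset.mem_univ _⟩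

lemma axw_cont (β ε h₀ lam : ℝ) (t : Bool) : Continuous (fun x => axw β ε h₀ lam x t) := by
  unfold axw axk; fun_prop

lemma axc_cont (β ε h₀ lam : ℝ) : Continuous (fun x => axc β ε h₀ lam x) := by
  unfold axc axw axk; fun_prop

lemma axc_int (β ε h₀ lam : ℝ) (hβ : 0 < β) : Integrable (fun x => axc β ε h₀ lam x) := by
  unfold axc axw axk
  exact integrable_finsetSum _ fun t _ => integrable_finsetSum _ fun s _ =>
    (ax_hs _ _ _ (half_pos hβ)).1

lemma axc_lim (β ε h₀ lam : ℝ) (hβ : 0 < β) :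
    Tendsto (fun x => axc β ε h₀ lam x) (cocompact ℝ) (nhds 0) := by
  unfold axc axw axk
  have : (0:ℝ) = ∑ t : Bool, ∑ s : Bool, 0 := by simp
  rw [this]
  exact tendsto_finsetSum _ fun t _ => tendsto_finsetSum _ fun s _ =>
    ax_quad_lim _ _ _ (half_pos hβ)

lemma ax_morH_prod (N : ℕ) (β ε h₀ lam : ℝ) (σ η : Fin N → Bool) (x : ℝ) :
    ∏ i, axk β ε h₀ lam x (σ i) (η i) =
      Real.exp (-(N * β / 2) * x ^ 2 + (β * ∑ i, spin (σ i)) * x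
        + (β * ∑ i, (ε * spin (η i) + h₀) * spin (σ i) + lam * ∑ i, spin (η i))) := by
  unfold axk
  rw [← Real.exp_sum]
  congr 1
  simp only [Finset.sum_add_distrib, Finset.mul_sum, Finset.sum_mul, Finset.sum_const,
    Finset.card_univ, Fintype.card_fin, nsmul_eq_mul, mul_assoc]
  ring

lemma ax_morH_int (N : ℕ) (hN : 0 < N) (β ε h₀ lam : ℝ) (hβ : 0 < β) (σ η : Fin N → Bool) :
    Integrable (fun x => ∏ i, axk β ε h₀ lam x (σ i) (η i)) ∧
    ∫ x, ∏ i, axk β ε h₀ lam x (σ i) (η i) =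
      √(π / (N * β / 2)) * Real.exp (morH N β ε h₀ lam σ η) := by
  have hN' : (0:ℝ) < N := by exact_mod_cast hN
  simp only [ax_morH_prod]
  have := ax_hs (N * β / 2) (β * ∑ i, spin (σ i)) 
    (β * ∑ i, (ε * spin (η i) + h₀) * spin (σ i) + lam * ∑ i, spin (η i)) (by positivity)
  refine ⟨this.1, this.2.trans ?_⟩
  congr 2
  unfold morH
  field_simp
  ring

lemma ax_ind_prod (N₀ N : ℕ) (hNN : N₀ ≤ N) (ηbar : Fin N₀ → Bool) (η : Fin N → Bool)
    (f : Fin N → ℝ) :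
    (if ∀ (i : Fin N₀) (h : (i : ℕ) < N), η ⟨i, h⟩ = ηbar i then ∏ j, f j else 0) =
    ∏ j : Fin N, (if ∀ h : (j : ℕ) < N₀, η j = ηbar ⟨j, h⟩ then f j else 0) := by
  split_ifs with hc
  · refine Finset.prod_congr rfl fun j _ => ?_
    rw [if_pos]
    intro h
    exact hc ⟨j, h⟩ j.2
  · push Not at hc
    obtain ⟨i, h, hne⟩ := hc
    symm
    apply Finset.prod_eq_zero (Finset.mem_univ (⟨i, h⟩ : Fin N))
    rw [if_neg]
    intro h2
    exact hne (h2 i.2)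

def axr (β ε h₀ lam x : ℝ) (t : Bool) : ℝ := axw β ε h₀ lam x t / axc β ε h₀ lam x

lemma ax_fin_prod (N₀ N : ℕ) (hNN : N₀ ≤ N) (f : Fin N₀ → ℝ) :
    ∏ j : Fin N, (if h : (j : ℕ) < N₀ then f ⟨j, h⟩ else 1) = ∏ i, f i := by
  obtain ⟨k, rfl⟩ := Nat.exists_eq_add_of_le hNN
  rw [Fin.prod_univ_add]
  simp

lemma ax_sum_eq (N₀ N : ℕ) (hNN : N₀ ≤ N) (β ε h₀ lam x : ℝ) (ηbar : Fin N₀ → Bool) :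
    ∑ σ : Fin N → Bool, ∑ η : Fin N → Bool,
      (if ∀ (i : Fin N₀) (h : (i : ℕ) < N), η ⟨i, h⟩ = ηbar i
        then ∏ j, axk β ε h₀ lam x (σ j) (η j) else 0)
    = (∏ i, axr β ε h₀ lam x (ηbar i)) * axc β ε h₀ lam x ^ N := by
  simp only [ax_ind_prod N₀ N hNN]
  have hσ : ∀ σ : Fin N → Bool, ∑ η : Fin N → Bool,
      ∏ j : Fin N, (if ∀ h : (j : ℕ) < N₀, η j = ηbar ⟨j, h⟩ then axk β ε h₀ lam x (σ j) (η j) else 0)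
      = ∏ j : Fin N, ∑ t : Bool, (if ∀ h : (j : ℕ) < N₀, t = ηbar ⟨j, h⟩ then
          axk β ε h₀ lam x (σ j) t else 0) := fun σ => by
    rw [Fintype.prod_sum]
  simp only [hσ]
  rw [← Fintype.prod_sum (fun (j : Fin N) (s : Bool) => ∑ t : Bool,
    (if ∀ h : (j : ℕ) < N₀, t = ηbar ⟨j, h⟩ then axk β ε h₀ lam x s t else 0))]
  rw [← ax_fin_prod N₀ N hNN (fun i => axr β ε h₀ lam x (ηbar i))]
  have : axc β ε h₀ lam x ^ N = ∏ j : Fin N, axc β ε h₀ lam x := by simp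
  rw [this, ← Finset.prod_mul_distrib]
  refine Finset.prod_congr rfl fun j _ => ?_
  rw [Finset.sum_comm]
  by_cases h : (j : ℕ) < N₀
  · simp only [h, dif_pos, forall_true_left, axr]
    rw [div_mul_cancel₀ _ (axc_pos _ _ _ _ _).ne']
    unfold axw
    cases ηbar ⟨j, h⟩ <;> simp
  · simp only [h, dif_neg, not_false_eq_true, IsEmpty.forall_iff, if_true, one_mul]
    rfl

lemma ax_num (N₀ N : ℕ) (hN : 0 < N) (hNN : N₀ ≤ N) (β ε h₀ lam : ℝ) (hβ : 0 < β)
    (ηbar : Fin N₀ → Bool) :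
    ∫ x, (∏ i, axr β ε h₀ lam x (ηbar i)) * axc β ε h₀ lam x ^ N =
    √(π / (N * β / 2)) * ∑ σ : Fin N → Bool, ∑ η : Fin N → Bool,
      (if ∀ (i : Fin N₀) (h : (i : ℕ) < N), η ⟨i, h⟩ = ηbar i
        then Real.exp (morH N β ε h₀ lam σ η) else 0) := by
  simp only [← ax_sum_eq N₀ N hNN]
  have hi : ∀ (σ η : Fin N → Bool), Integrable (fun x => 
      (if ∀ (i : Fin N₀) (h : (i : ℕ) < N), η ⟨i, h⟩ = ηbar i
        then ∏ j, axk β ε h₀ lam x (σ j) (η j) else 0)) := by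
    intro σ η
    split_ifs
    · exact (ax_morH_int N hN β ε h₀ lam hβ σ η).1
    · exact integrable_zero _ _ _
  rw [integral_finsetSum _ fun σ _ => integrable_finsetSum _ fun η _ => hi σ η, Finset.mul_sum]
  refine Finset.sum_congr rfl fun σ _ => ?_
  rw [integral_finsetSum _ fun η _ => hi σ η, Finset.mul_sum]
  refine Finset.sum_congr rfl fun η _ => ?_
  split_ifs
  · exact (ax_morH_int N hN β ε h₀ lam hβ σ η).2
  · simp

lemma ax_etaCyl (N₀ N : ℕ) (hN : 0 < N) (hNN : N₀ ≤ N) (β ε h₀ lam : ℝ) (hβ : 0 < β)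
    (ηbar : Fin N₀ → Bool) :
    etaCylProb N₀ N β ε h₀ lam ηbar =
    (∫ x, (∏ i, axr β ε h₀ lam x (ηbar i)) * axc β ε h₀ lam x ^ N) /
      ∫ x, axc β ε h₀ lam x ^ N := by
  have hZ := ax_num 0 N hN (Nat.zero_le _) β ε h₀ lam hβ Fin.elim0
  simp only [Finset.univ_eq_empty, Finset.prod_empty, one_mul, IsEmpty.forall_iff, if_true] at hZ
  rw [ax_num N₀ N hN hNN β ε h₀ lam hβ, hZ]
  have hN' : (0:ℝ) < N := by exact_mod_cast hN
  rw [mul_div_mul_left _ _ (by positivity)]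
  unfold etaCylProb morK morZ
  rw [Finset.sum_div]
  refine Finset.sum_congr rfl fun σ _ => ?_
  rw [Finset.sum_div]
  refine Finset.sum_congr rfl fun η _ => ?_
  split_ifs <;> simp

lemma ax_hbar_exp (β ε l : ℝ) (hβ : 0 < β) :
    Real.exp (-(β * hbar β ε l)) * Real.cosh (β * ε + l) =
      Real.exp (β * hbar β ε l) * Real.cosh (β * ε - l) := by
  have h1 : Real.exp (β * hbar β ε l) * Real.exp (β * hbar β ε l)
      = Real.cosh (l + β * ε) / Real.cosh (l - β * ε) := by
    rw [← Real.exp_add]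
    have : β * hbar β ε l + β * hbar β ε l
        = Real.log (Real.cosh (l + β * ε) / Real.cosh (l - β * ε)) := by
      unfold hbar; field_simp; ring
    rw [this, Real.exp_log (div_pos (Real.cosh_pos _) (Real.cosh_pos _))]
  rw [← Real.cosh_neg (β * ε - l), neg_sub, add_comm (β * ε) l, Real.exp_neg]
  have h2 := Real.cosh_pos (l - β * ε)
  have h3 := Real.exp_pos (β * hbar β ε l)
  rw [eq_div_iff h2.ne'] at h1
  field_simp
  rw [← h1]; ring

lemma ax_w_true (β ε h₀ l x : ℝ) : axw β ε h₀ (-l) x true =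
    Real.exp (-(β / 2) * x ^ 2) * (Real.exp (β * (x + (h₀ - hbar β ε l))) *
      Real.exp (β * hbar β ε l) * Real.exp (β * ε - l) +
      Real.exp (-(β * (x + (h₀ - hbar β ε l)))) * Real.exp (-(β * hbar β ε l)) *
        Real.exp (-(β * ε + l))) := by
  simp only [axw, axk, Fintype.sum_bool, spin, if_true, Bool.false_eq_true, if_false]
  rw [mul_add (Real.exp _)]
  simp only [← Real.exp_add]
  congr 2 <;> ring

lemma ax_w_false (β ε h₀ l x : ℝ) : axw β ε h₀ (-l) x false =
    Real.exp (-(β / 2) * x ^ 2) * (Real.exp (β * (x + (h₀ - hbar β ε l))) *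
      Real.exp (β * hbar β ε l) * Real.exp (-(β * ε - l)) +
      Real.exp (-(β * (x + (h₀ - hbar β ε l)))) * Real.exp (-(β * hbar β ε l)) *
        Real.exp (β * ε + l)) := by
  simp only [axw, axk, Fintype.sum_bool, spin, if_true, Bool.false_eq_true, if_false]
  rw [mul_add (Real.exp _)]
  simp only [← Real.exp_add]
  congr 2 <;> ring

def axD (β ε l : ℝ) : ℝ := 4 * (Real.exp (β * hbar β ε l) * Real.cosh (β * ε - l))

lemma axD_pos (β ε l : ℝ) : 0 < axD β ε l := by
  unfold axD; have := Real.cosh_pos (β * ε - l); positivity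

lemma ax_c_form (β ε h₀ l x : ℝ) (hβ : 0 < β) : axc β ε h₀ (-l) x =
    axD β ε l * (Real.exp (-(β / 2) * x ^ 2) * Real.cosh (β * (x + (h₀ - hbar β ε l)))) := by
  have h := ax_hbar_exp β ε l hβ
  unfold axD
  rw [axc, Fintype.sum_bool, ax_w_true, ax_w_false, Real.cosh_eq (β * (x + _))]
  have e1 : Real.exp (-(β * ε - l)) = 2 * Real.cosh (β * ε - l) - Real.exp (β * ε - l) := by
    rw [Real.cosh_eq]; ring
  have e2 : Real.exp (-(β * ε + l)) = 2 * Real.cosh (β * ε + l) - Real.exp (β * ε + l) := by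
    rw [Real.cosh_eq]; ring
  rw [e1, e2]
  linear_combination (2 * Real.exp (-(β / 2) * x ^ 2) *
    Real.exp (-(β * (x + (h₀ - hbar β ε l))))) * h

def axA (β ε l : ℝ) : ℝ := (Real.tanh (β * ε - l) - Real.tanh (β * ε + l)) / 2
def axB (β ε l : ℝ) : ℝ := (Real.tanh (β * ε - l) + Real.tanh (β * ε + l)) / 2

lemma ax_diff (β ε h₀ l x : ℝ) (hβ : 0 < β) :
    axw β ε h₀ (-l) x true - axw β ε h₀ (-l) x false = axc β ε h₀ (-l) x *
      (axA β ε l + axB β ε l * Real.tanh (β * (x + (h₀ - hbar β ε l)))) := by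
  have h := ax_hbar_exp β ε l hβ
  rw [ax_c_form _ _ _ _ _ hβ, ax_w_true, ax_w_false]
  unfold axD axA axB
  have c3 := Real.cosh_pos (β * (x + (h₀ - hbar β ε l)))
  have e3 : Real.tanh (β * (x + (h₀ - hbar β ε l))) * Real.cosh (β * (x + (h₀ - hbar β ε l)))
    = Real.sinh (β * (x + (h₀ - hbar β ε l))) := by
    rw [Real.tanh_eq_sinh_div_cosh]; field_simp
  have e1 : Real.exp (β * ε - l) - Real.exp (-(β * ε - l)) =
      2 * (Real.tanh (β * ε - l) * Real.cosh (β * ε - l)) := by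
    have := Real.cosh_pos (β * ε - l)
    rw [Real.tanh_eq_sinh_div_cosh, div_mul_cancel₀ _ this.ne', Real.sinh_eq]; ring
  have e2 : Real.exp (-(β * ε + l)) - Real.exp (β * ε + l) =
      -2 * (Real.tanh (β * ε + l) * Real.cosh (β * ε + l)) := by
    have := Real.cosh_pos (β * ε + l)
    rw [Real.tanh_eq_sinh_div_cosh, div_mul_cancel₀ _ this.ne', Real.sinh_eq]; ring
  rw [Real.cosh_eq (β * (x + _)), Real.sinh_eq (β * (x + _))] at e3
  rw [Real.cosh_eq (β * (x + _))]
  generalize Real.exp (-(β / 2) * x ^ 2) = E at *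
  generalize Real.exp (β * (x + (h₀ - hbar β ε l))) = Y at *
  generalize Real.exp (-(β * (x + (h₀ - hbar β ε l)))) = Yi at *
  generalize Real.exp (β * hbar β ε l) = H at *
  generalize Real.exp (-(β * hbar β ε l)) = Hi at *
  generalize Real.tanh (β * ε - l) = t1 at *
  generalize Real.tanh (β * ε + l) = t2 at *
  generalize Real.tanh (β * (x + (h₀ - hbar β ε l))) = T at *
  generalize Real.cosh (β * ε - l) = p at *
  generalize Real.cosh (β * ε + l) = q at *
  linear_combination E * Y * H * e1 + E * Yi * Hi * e2 - 2 * E * Yi * t2 * h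
    - 2 * E * H * p * (t1 + t2) * e3

lemma ax_r_form (β ε h₀ l x : ℝ) (hβ : 0 < β) (t : Bool) :
    axr β ε h₀ (-l) x t = (1 + spin t *
      (axA β ε l + axB β ε l * Real.tanh (β * (x + (h₀ - hbar β ε l))))) / 2 := by
  have h := ax_diff β ε h₀ l x hβ
  have hp := axc_pos β ε h₀ (-l) x
  have h2 : axc β ε h₀ (-l) x = axw β ε h₀ (-l) x true + axw β ε h₀ (-l) x false := by
    simp [axc]
  unfold axr
  rw [div_eq_iff hp.ne']
  cases t
  · simp only [spin, Bool.false_eq_true, if_false]; linarith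
  · simp only [spin, if_true]; linarith

lemma ax_r_bd (β ε h₀ lam x : ℝ) (t : Bool) : |axr β ε h₀ lam x t| ≤ 1 := by
  have hp := axc_pos β ε h₀ lam x
  have h1 := axw_pos β ε h₀ lam x
  unfold axr
  rw [abs_of_pos (div_pos (h1 t) hp), div_le_one hp]
  have h2 : axc β ε h₀ lam x = axw β ε h₀ lam x true + axw β ε h₀ lam x false := by
    simp [axc]
  cases t
  · linarith [h1 true]
  · linarith [h1 false]

lemma ax_r_cont (β ε h₀ lam : ℝ) (t : Bool) : Continuous (fun x => axr β ε h₀ lam x t) := by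
  unfold axr
  exact (axw_cont _ _ _ _ _).div (axc_cont _ _ _ _) fun x => (axc_pos _ _ _ _ x).ne'

lemma ax_exists_max (β ε h₀ lam : ℝ) (hβ : 0 < β) :
    ∃ z, ∀ x, axc β ε h₀ lam x ≤ axc β ε h₀ lam z := by
  apply (axc_cont β ε h₀ lam).exists_forall_ge' 0
  filter_upwards [(axc_lim β ε h₀ lam hβ).eventually_lt_const (axc_pos β ε h₀ lam 0)] with x hx
  exact hx.le

lemma ax_max_eq (β ε h₀ l : ℝ) (hβ : 0 < β) (hh : 0 < h₀ - hbar β ε l) (z : ℝ)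
    (hz : ∀ x, axc β ε h₀ (-l) x ≤ axc β ε h₀ (-l) z) :
    0 < z ∧ z = Real.tanh (β * (z + (h₀ - hbar β ε l))) := by
  set h := h₀ - hbar β ε l with hdef
  have hD := axD_pos β ε l
  have hc : ∀ x, axc β ε h₀ (-l) x =
    axD β ε l * (Real.exp (-(β / 2) * x ^ 2) * Real.cosh (β * (x + h))) :=
    fun x => ax_c_form β ε h₀ l x hβ
  have hz' : ∀ x, Real.exp (-(β / 2) * x ^ 2) * Real.cosh (β * (x + h)) ≤
      Real.exp (-(β / 2) * z ^ 2) * Real.cosh (β * (z + h)) := fun x => by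
    have := hz x
    rw [hc, hc] at this
    exact le_of_mul_le_mul_left this hD
  have hcrit : z = Real.tanh (β * (z + h)) := by
    have hd : HasDerivAt (fun x => Real.exp (-(β / 2) * x ^ 2) * Real.cosh (β * (x + h)))
        ((Real.exp (-(β / 2) * z ^ 2) * (-(β / 2) * (2 * z))) * Real.cosh (β * (z + h)) +
          Real.exp (-(β / 2) * z ^ 2) * (Real.sinh (β * (z + h)) * β)) z := by
      apply HasDerivAt.mul
      · apply HasDerivAt.exp
        simpa using (hasDerivAt_pow 2 z).const_mul (-(β / 2))
      · apply HasDerivAt.cosh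
        simpa using ((hasDerivAt_id z).add_const h).const_mul β
    have h0 := IsLocalMax.hasDerivAt_eq_zero (Eventually.of_forall hz') hd
    have hE := Real.exp_pos (-(β / 2) * z ^ 2)
    have hC := Real.cosh_pos (β * (z + h))
    rw [Real.tanh_eq_sinh_div_cosh, eq_div_iff hC.ne']
    have : Real.exp (-(β / 2) * z ^ 2) * β *
        (Real.sinh (β * (z + h)) - z * Real.cosh (β * (z + h))) = 0 := by
      linear_combination h0
    rcases mul_eq_zero.1 this with h1 | h1
    · exact absurd h1 (by positivity)
    · linarith
  refine ⟨?_, hcrit⟩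
  by_contra hneg
  push Not at hneg
  rcases hneg.lt_or_eq with hlt | heq
  · have h1 := hz' (-z)
    rw [neg_sq] at h1
    have h2 := le_of_mul_le_mul_left h1 (Real.exp_pos _)
    rw [Real.cosh_le_cosh, abs_mul, abs_mul] at h2
    have h3 := le_of_mul_le_mul_left h2 (abs_pos.2 hβ.ne')
    rw [abs_of_pos (by linarith : 0 < -z + h)] at h3
    rcases le_abs.1 h3 with h4 | h4 <;> linarith
  · rw [heq] at hcrit
    have := ax_tanh_strictMono (show (0:ℝ) < β * (0 + h) by positivity)
    rw [Real.tanh_zero] at this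
    linarith

lemma ax_unique_max (β ε h₀ l m : ℝ) (hβ : 0 < β) (hh : 0 < h₀ - hbar β ε l) (hm : 0 < m)
    (hme : m = Real.tanh (β * (m + (h₀ - hbar β ε l)))) :
    ∀ x, x ≠ m → axc β ε h₀ (-l) x < axc β ε h₀ (-l) m := by
  have key : ∀ z, (∀ x, axc β ε h₀ (-l) x ≤ axc β ε h₀ (-l) z) → z = m := fun z hz => by
    obtain ⟨h1, h2⟩ := ax_max_eq β ε h₀ l hβ hh z hz
    exact ax_cw_unique hβ hh.le h1 hm h2 hme
  obtain ⟨z, hz⟩ := ax_exists_max β ε h₀ (-l) hβ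
  have := key z hz
  subst this
  intro x hx
  refine lt_of_le_of_ne (hz x) fun he => hx (key x fun y => ?_)
  rw [he]; exact hz y

lemma ax_limit (β ε h₀ l m : ℝ) (hβ : 0 < β) (hh : 0 < h₀ - hbar β ε l) (hm : 0 < m)
    (hme : m = Real.tanh (β * (m + (h₀ - hbar β ε l)))) (N₀ : ℕ) (ηbar : Fin N₀ → Bool) :
    Tendsto (fun N => etaCylProb N₀ N β ε h₀ (-l) ηbar) atTop
      (nhds (∏ i, (1 + spin (ηbar i) * (axA β ε l + axB β ε l * m)) / 2)) := by
  have h1 := ax_laplace (fun x => axc β ε h₀ (-l) x) (fun x => ∏ i, axr β ε h₀ (-l) x (ηbar i))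
    m 1 (axc_cont _ _ _ _) (axc_pos _ _ _ _) (axc_int _ _ _ _ hβ)
    (ax_unique_max β ε h₀ l m hβ hh hm hme) (axc_lim _ _ _ _ hβ)
    (continuous_finsetProd _ fun i _ => ax_r_cont _ _ _ _ _)
    (fun x => by
      rw [Finset.abs_prod]
      exact Finset.prod_le_one (fun _ _ => abs_nonneg _) fun i _ => ax_r_bd _ _ _ _ _ _)
  have h2 : ∏ i, axr β ε h₀ (-l) m (ηbar i) =
      ∏ i, (1 + spin (ηbar i) * (axA β ε l + axB β ε l * m)) / 2 := by
    refine Finset.prod_congr rfl fun i _ => ?_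
    rw [ax_r_form _ _ _ _ _ hβ, ← hme]
  rw [← h2]
  refine h1.congr' ?_
  filter_upwards [eventually_ge_atTop (max 1 N₀)] with N hN
  exact (ax_etaCyl N₀ N (by have := le_max_left 1 N₀; omega) ((le_max_right _ _).trans hN)
    β ε h₀ (-l) hβ ηbar).symm

lemma ax_B_pos (β ε l : ℝ) (hβ : 0 < β) (hε : 0 < ε) : 0 < axB β ε l := by
  unfold axB
  have := ax_tanh_strictMono (show -(β * ε - l) < β * ε + l by nlinarith [mul_pos hβ hε])
  rw [Real.tanh_neg] at this
  linarith

lemma ax_A_neg (β ε l : ℝ) (hl : 0 < l) : axA β ε l < 0 := by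
  unfold axA
  have := ax_tanh_strictMono (show β * ε - l < β * ε + l by linarith)
  linarith

lemma ax_AB (β ε l m : ℝ) (hβ : 0 < β) (hε : 0 < ε) :
    axA β ε l + axB β ε l * m = 0 ↔ m = Real.sinh (2 * l) / Real.sinh (2 * β * ε) := by
  have hs : 0 < Real.sinh (2 * β * ε) := Real.sinh_pos_iff.2 (by positivity)
  have hp := Real.cosh_pos (β * ε - l)
  have hq := Real.cosh_pos (β * ε + l)
  have e1 : Real.sinh (2 * l) = Real.sinh (β * ε + l) * Real.cosh (β * ε - l)
      - Real.cosh (β * ε + l) * Real.sinh (β * ε - l) := by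
    rw [← Real.sinh_sub]; congr 1; ring
  have e2 : Real.sinh (2 * β * ε) = Real.sinh (β * ε + l) * Real.cosh (β * ε - l)
      + Real.cosh (β * ε + l) * Real.sinh (β * ε - l) := by
    rw [← Real.sinh_add]; congr 1; ring
  have h1 : axA β ε l = - Real.sinh (2 * l) /
      (2 * Real.cosh (β * ε - l) * Real.cosh (β * ε + l)) := by
    rw [e1, axA, Real.tanh_eq_sinh_div_cosh, Real.tanh_eq_sinh_div_cosh]; field_simp; ring
  have h2 : axB β ε l = Real.sinh (2 * β * ε) /
      (2 * Real.cosh (β * ε - l) * Real.cosh (β * ε + l)) := by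
    rw [e2, axB, Real.tanh_eq_sinh_div_cosh, Real.tanh_eq_sinh_div_cosh]; field_simp; ring
  rw [h1, h2, div_mul_eq_mul_div, ← add_div, div_eq_zero_iff, eq_div_iff hs.ne']
  constructor
  · rintro (h | h)
    · linarith
    · exact absurd h (by positivity)
  · intro h; left; linarith

lemma ax_neg_int (β ε h₀ l : ℝ) (hβ : 0 < β) (hh : h₀ - hbar β ε l ≤ 0) (N : ℕ) :
    Integrable (fun x => Real.tanh (β * (x + (h₀ - hbar β ε l))) * axc β ε h₀ (-l) x ^ (N+1)) ∧
    ∫ x, Real.tanh (β * (x + (h₀ - hbar β ε l))) * axc β ε h₀ (-l) x ^ (N+1) ≤ 0 := by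
  obtain ⟨z, hz⟩ := ax_exists_max β ε h₀ (-l) hβ
  have hI := ax_pow_int _ _ (axc_cont β ε h₀ (-l)) (axc_pos β ε h₀ (-l)) hz
    (axc_int β ε h₀ (-l) hβ) N
  have hcf := fun x => ax_c_form β ε h₀ l x hβ
  set h := h₀ - hbar β ε l with hdef
  have hJ : Integrable (fun x => Real.tanh (β * (x + h)) * axc β ε h₀ (-l) x ^ (N+1)) := by
    refine hI.bdd_mul (c := 1) ?_ (Eventually.of_forall fun x => ?_)
    · exact (ax_tanh_cont.comp (by fun_prop)).aestronglyMeasurable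
    · rw [Real.norm_eq_abs]
      have := ax_tanh_bd (β * (x + h))
      exact abs_le.2 ⟨this.1.le, this.2.le⟩
  refine ⟨hJ, ?_⟩
  set F := fun y => Real.tanh (β * y) * axc β ε h₀ (-l) (y - h) ^ (N+1) with hF
  have hFi : Integrable F := by
    have := hJ.comp_sub_right h
    simpa [hF] using this
  have hFe : ∫ x, Real.tanh (β * (x + h)) * axc β ε h₀ (-l) x ^ (N+1) = ∫ y, F y := by
    rw [← integral_sub_right_eq_self _ h]
    simp [hF]
  have hcomp : ∀ y, 0 ≤ y → axc β ε h₀ (-l) (y - h) ≤ axc β ε h₀ (-l) (-y - h) := by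
    intro y hy
    rw [hcf, hcf]
    have e1 : Real.cosh (β * (-y - h + h)) = Real.cosh (β * (y - h + h)) := by
      rw [← Real.cosh_neg]; congr 1; ring
    rw [e1]
    have := axD_pos β ε l
    have := Real.cosh_pos (β * (y - h + h))
    have h5 : -(β / 2) * (y - h) ^ 2 ≤ -(β / 2) * (-y - h) ^ 2 := by
      nlinarith [mul_nonneg hβ.le (mul_nonneg hy (neg_nonneg.2 hh))]
    have h6 := Real.exp_le_exp.2 h5
    gcongr
  have hsum : ∀ y, F y + F (-y) ≤ 0 := by
    have aux : ∀ y, 0 ≤ y → F y + F (-y) ≤ 0 := by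
      intro y hy
      have h1 := pow_le_pow_left₀ (axc_pos β ε h₀ (-l) _).le (hcomp y hy) (N+1)
      have h2 : 0 ≤ Real.tanh (β * y) := by
        rw [← Real.tanh_zero]; exact ax_tanh_strictMono.monotone (by positivity)
      simp only [hF, mul_neg, Real.tanh_neg]
      nlinarith
    intro y
    rcases le_total 0 y with hy | hy
    · exact aux y hy
    · have := aux (-y) (by linarith)
      rw [neg_neg] at this; linarith
  have h3 : ∫ y, (F y + F (-y)) ≤ 0 := integral_nonpos hsum
  rw [integral_add hFi hFi.comp_neg, integral_neg_eq_self F] at h3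
  linarith

lemma ax_not_neutral (β ε h₀ l : ℝ) (hβ : 0 < β) (hε : 0 < ε) (hl : 0 < l)
    (hh : h₀ - hbar β ε l ≤ 0) : ¬ IsNeutral β ε h₀ (-l) := by
  intro hn
  have h1 := hn 1 (fun _ => true)
  have hle : ∀ᶠ N in atTop, etaCylProb 1 N β ε h₀ (-l) (fun _ => true) ≤ (1 + axA β ε l) / 2 := by
    filter_upwards [eventually_ge_atTop 1] with N hN
    obtain ⟨n, rfl⟩ := Nat.exists_eq_add_of_le' hN
    rw [ax_etaCyl 1 (n+1) (by omega) (by omega) β ε h₀ (-l) hβ]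
    obtain ⟨z, hz⟩ := ax_exists_max β ε h₀ (-l) hβ
    have hI := ax_pow_int _ _ (axc_cont β ε h₀ (-l)) (axc_pos β ε h₀ (-l)) hz
      (axc_int β ε h₀ (-l) hβ) n
    obtain ⟨hJ, hJ0⟩ := ax_neg_int β ε h₀ l hβ hh n
    have hpos : 0 ≤ ∫ x, axc β ε h₀ (-l) x ^ (n+1) :=
      integral_nonneg fun x => (pow_pos (axc_pos β ε h₀ (-l) x) _).le
    have heq : ∫ x, (∏ i : Fin 1, axr β ε h₀ (-l) x true) * axc β ε h₀ (-l) x ^ (n+1) =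
        (1 + axA β ε l) / 2 * (∫ x, axc β ε h₀ (-l) x ^ (n+1)) + axB β ε l / 2 *
        ∫ x, Real.tanh (β * (x + (h₀ - hbar β ε l))) * axc β ε h₀ (-l) x ^ (n+1) := by
      rw [← integral_const_mul, ← integral_const_mul,
        ← integral_add (hI.const_mul _) (hJ.const_mul _)]
      congr 1; ext x
      simp only [Finset.univ_unique, Finset.prod_singleton, ax_r_form _ _ _ _ _ hβ, spin, if_true]
      ring
    rw [heq]
    have hB := ax_B_pos β ε l hβ hε
    rcases hpos.eq_or_lt with h0 | h0
    · rw [← h0, div_zero]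
      have := ax_tanh_bd (β * ε - l)
      have := ax_tanh_bd (β * ε + l)
      unfold axA; linarith
    · rw [div_le_iff₀ h0]
      nlinarith
  have h2 := le_of_tendsto h1 hle
  have := ax_A_neg β ε l hl
  norm_num at h2
  linarith

lemma ax_hbar_strictMono (β ε : ℝ) (hβ : 0 < β) (hε : 0 < ε) :
    StrictMono (hbar β ε) := by
  intro x y hxy
  unfold hbar
  have h1 := Real.cosh_pos (x + β * ε)
  have h2 := Real.cosh_pos (x - β * ε)
  have h3 := Real.cosh_pos (y + β * ε)
  have h4 := Real.cosh_pos (y - β * ε)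
  apply mul_lt_mul_of_pos_left _ (by positivity)
  apply Real.log_lt_log (by positivity)
  rw [div_lt_div_iff₀ h2 h4]
  have h5 := mul_pos (Real.sinh_pos_iff.2 (sub_pos.2 hxy))
    (Real.sinh_pos_iff.2 (show 0 < 2 * (β * ε) by positivity))
  rw [Real.sinh_sub, Real.sinh_two_mul] at h5
  rw [Real.cosh_add, Real.cosh_add, Real.cosh_sub, Real.cosh_sub]
  nlinarith

lemma ax_hbar_zero (β ε : ℝ) : hbar β ε 0 = 0 := by
  unfold hbar
  rw [zero_add, zero_sub, Real.cosh_neg, div_self (Real.cosh_pos _).ne', Real.log_one, mul_zero]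

lemma ax_hbar_cont (β ε : ℝ) : Continuous (hbar β ε) := by
  unfold hbar
  refine continuous_const.mul (Continuous.log ?_ fun x =>
    (div_pos (Real.cosh_pos _) (Real.cosh_pos _)).ne')
  exact (Real.continuous_cosh.comp (by fun_prop)).div (Real.continuous_cosh.comp (by fun_prop))
    fun x => (Real.cosh_pos _).ne'

lemma ax_part1 (β ε : ℝ) (hβ : 0 < β) (hε : 0 < ε)
    (mCW : ℝ → ℝ)
    (hmCW : ∀ h : ℝ, 0 < h → mCW h = Real.tanh (β * (mCW h + h)) ∧ 0 < mCW h)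
    (h₀ l : ℝ) (hl : 0 < l) :
      (IsNeutral β ε h₀ (-l) ↔
        (0 < hbar β ε l ∧ hbar β ε l < h₀ ∧
          mCW (h₀ - hbar β ε l) = Real.sinh (2 * l) / Real.sinh (2 * β * ε))) := by
  have hb : 0 < hbar β ε l := by
    rw [← ax_hbar_zero β ε]; exact ax_hbar_strictMono β ε hβ hε hl
  constructor
  · intro hn
    have hh : 0 < h₀ - hbar β ε l := by
      by_contra hc
      exact ax_not_neutral β ε h₀ l hβ hε hl (not_lt.1 hc) hn
    refine ⟨hb, by linarith, ?_⟩
    obtain ⟨e, p⟩ := hmCW _ hh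
    have h1 := ax_limit β ε h₀ l _ hβ hh p e 1 (fun _ => true)
    have h2 := tendsto_nhds_unique h1 (hn 1 (fun _ => true))
    rw [← ax_AB β ε l _ hβ hε]
    simp [spin] at h2
    linarith
  · rintro ⟨-, h1, h2⟩
    have hh : 0 < h₀ - hbar β ε l := by linarith
    obtain ⟨e, p⟩ := hmCW _ hh
    intro N₀ ηbar
    have h3 := ax_limit β ε h₀ l _ hβ hh p e N₀ ηbar
    rw [← ax_AB β ε l _ hβ hε] at h2
    rw [h2] at h3
    simpa using h3

def axH (β t : ℝ) : ℝ := Real.artanh t / β - t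

lemma axH_cont (β a b : ℝ) (ha : 0 ≤ a) (hb : b < 1) : ContinuousOn (axH β) (Set.Icc a b) := by
  have : ContinuousOn (fun t : ℝ => 1 / 2 * Real.log ((1 + t) / (1 - t)) / β - t) (Set.Icc a b) := by
    apply ContinuousOn.sub _ continuousOn_id
    apply ContinuousOn.div_const
    apply ContinuousOn.mul continuousOn_const
    apply ContinuousOn.log
    · apply ContinuousOn.div (by fun_prop) (by fun_prop)
      intro x hx
      have := hx.2
      linarith
    · intro x hx
      have h1 := hx.1
      have h2 := hx.2
      exact (div_pos (by linarith) (by linarith)).ne'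
  refine this.congr fun t ht => ?_
  unfold axH
  rw [Real.artanh_eq_half_log ⟨by linarith [ht.1], by linarith [ht.2]⟩]

lemma axH_eq (β t : ℝ) (hβ : 0 < β) (h0 : 0 ≤ t) (h1 : t < 1) :
    t = Real.tanh (β * (t + axH β t)) := by
  have : β * (t + axH β t) = Real.artanh t := by unfold axH; field_simp; ring
  rw [this, Real.tanh_artanh ⟨by linarith, h1⟩]

lemma axH_pos (β t m0 : ℝ) (hβ : 0 < β) (h0 : 0 ≤ m0)
    (hm0max : ∀ m : ℝ, m = Real.tanh (β * m) → m ≤ m0) (ht : m0 < t) (h1 : t < 1) :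
    0 < axH β t := by
  by_contra hc
  push Not at hc
  have e := axH_eq β t hβ (by linarith) h1
  have h2 : t ≤ Real.tanh (β * t) := by
    have := ax_tanh_strictMono.monotone (show β * (t + axH β t) ≤ β * t by nlinarith)
    linarith
  have hcont : ContinuousOn (fun x => Real.tanh (β * x) - x) (Set.Icc t 1) :=
    ((ax_tanh_cont.comp (by fun_prop)).sub continuous_id).continuousOn
  have h3 := intermediate_value_Icc' h1.le hcont
  have h4 : (0:ℝ) ∈ Set.Icc (Real.tanh (β * 1) - 1) (Real.tanh (β * t) - t) :=
    ⟨by linarith [(ax_tanh_bd (β * 1)).2], by linarith⟩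
  obtain ⟨m, hm, hm2⟩ := h3 h4
  have := hm0max m (by simp only at hm2; linarith)
  linarith [hm.1]

/-- Explicit description of (the positive-`h₀` branch of) the neutral set.
Here `mCW h` is the Curie–Weiss magnetization, i.e. for `h > 0` the unique positive
solution of `m = tanh(β(m+h))`, and `m0 = m^{CW}(β,0+)` is the largest solution
of `m = tanh(βm)`. -/
theorem stmt4 (β ε : ℝ) (hβ : 0 < β) (hε : 0 < ε)
    (mCW : ℝ → ℝ)
    (hmCW : ∀ h : ℝ, 0 < h → mCW h = Real.tanh (β * (mCW h + h)) ∧ 0 < mCW h)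
    (m0 : ℝ) (hm0 : m0 = Real.tanh (β * m0))
    (hm0max : ∀ m : ℝ, m = Real.tanh (β * m) → m ≤ m0) :
    (∀ h₀ l : ℝ, 0 < l →
      (IsNeutral β ε h₀ (-l) ↔
        (0 < hbar β ε l ∧ hbar β ε l < h₀ ∧
          mCW (h₀ - hbar β ε l) = Real.sinh (2 * l) / Real.sinh (2 * β * ε)))) ∧
    ∃ lfun : ℝ → ℝ,
      ContinuousOn lfun (Set.Ioi (hbar β ε (1 / 2 * Real.arsinh (Real.sinh (2 * β * ε) * m0)))) ∧
      StrictMonoOn lfun (Set.Ioi (hbar β ε (1 / 2 * Real.arsinh (Real.sinh (2 * β * ε) * m0)))) ∧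
      Set.BijOn lfun (Set.Ioi (hbar β ε (1 / 2 * Real.arsinh (Real.sinh (2 * β * ε) * m0))))
        (Set.Ioo (1 / 2 * Real.arsinh (Real.sinh (2 * β * ε) * m0)) (β * ε)) ∧
      {p : ℝ × ℝ | 0 < -p.2 ∧ IsNeutral β ε p.1 p.2} =
        (fun h₀ => (h₀, -lfun h₀)) ''
          Set.Ioi (hbar β ε (1 / 2 * Real.arsinh (Real.sinh (2 * β * ε) * m0))) := by
  have P1 := ax_part1 β ε hβ hε mCW hmCW
  refine ⟨P1, ?_⟩
  have hS : 0 < Real.sinh (2 * β * ε) := Real.sinh_pos_iff.2 (by positivity)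
  have hm0n : 0 ≤ m0 := hm0max 0 (by simp)
  have hm01 : m0 < 1 := by rw [hm0]; exact (ax_tanh_bd _).2
  set lm := 1 / 2 * Real.arsinh (Real.sinh (2 * β * ε) * m0) with hlm
  set s : ℝ → ℝ := fun l => Real.sinh (2 * l) / Real.sinh (2 * β * ε) with hs
  have hsmono : StrictMono s := fun x y hxy =>
    div_lt_div_of_pos_right (Real.sinh_lt_sinh.2 (by linarith)) hS
  have hscont : Continuous s := by simp only [hs]; fun_prop
  have hslm : s lm = m0 := by
    simp only [hs, hlm]
    rw [show 2 * (1 / 2 * Real.arsinh (Real.sinh (2 * β * ε) * m0))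
      = Real.arsinh (Real.sinh (2 * β * ε) * m0) by ring, Real.sinh_arsinh]
    field_simp
  have hsend : s (β * ε) = 1 := by
    simp only [hs]
    rw [show 2 * (β * ε) = 2 * β * ε by ring, div_self hS.ne']
  have hs0 : s 0 = 0 := by simp [hs]
  have hlm0 : 0 ≤ lm := by rw [← hsmono.le_iff_le, hs0, hslm]; exact hm0n
  set G : ℝ → ℝ := fun l => hbar β ε l + axH β (s l) with hG
  have hrange : ∀ l, l ∈ Set.Ioo lm (β * ε) ↔ m0 < s l ∧ s l < 1 := fun l => by
    rw [Set.mem_Ioo, ← hslm, ← hsend, hsmono.lt_iff_lt, hsmono.lt_iff_lt]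
  have hHpos : ∀ l ∈ Set.Ioo lm (β * ε), 0 < axH β (s l) := fun l hl => by
    obtain ⟨h1, h2⟩ := (hrange l).1 hl
    exact axH_pos β _ m0 hβ hm0n hm0max h1 h2
  have hHeq : ∀ l ∈ Set.Ioo lm (β * ε), s l = Real.tanh (β * (s l + axH β (s l))) := fun l hl => by
    obtain ⟨h1, h2⟩ := (hrange l).1 hl
    exact axH_eq β _ hβ (by linarith) h2
  have hH0 : axH β m0 = 0 := by
    unfold axH
    have : Real.artanh m0 = β * m0 := by
      conv_lhs => rw [hm0]
      exact Real.artanh_tanh _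
    rw [this]; field_simp; ring
  have hspos : ∀ l ∈ Set.Ioo lm (β * ε), 0 < s l := fun l hl => by
    linarith [((hrange l).1 hl).1]
  have F2 : ∀ h₀ l : ℝ, 0 < l → (IsNeutral β ε h₀ (-l) ↔ l ∈ Set.Ioo lm (β * ε) ∧ G l = h₀) := by
    intro h₀ l hl
    rw [P1 h₀ l hl]
    constructor
    · rintro ⟨_, h2, h3⟩
      have hh : 0 < h₀ - hbar β ε l := by linarith
      obtain ⟨e, p⟩ := hmCW _ hh
      change mCW (h₀ - hbar β ε l) = s l at h3
      rw [h3] at e p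
      have hs1 : s l < 1 := by rw [e]; exact (ax_tanh_bd _).2
      have hart : Real.artanh (s l) = β * (s l + (h₀ - hbar β ε l)) := by
        conv_lhs => rw [e]
        exact Real.artanh_tanh _
      have hH : axH β (s l) = h₀ - hbar β ε l := by
        unfold axH; rw [hart]; field_simp; ring
      refine ⟨(hrange l).2 ⟨?_, hs1⟩, by simp only [hG, hH]; ring⟩
      rcases hm0n.eq_or_lt with h0 | h0
      · rw [← h0]; exact p
      · have hle : m0 ≤ s l := ax_cw_mono (h1 := 0) hβ le_rfl hh.le h0 p (by rw [add_zero]; exact hm0) e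
        refine lt_of_le_of_ne hle fun heq => ?_
        rw [← heq, hH0] at hH
        linarith
    · rintro ⟨h1, h2⟩
      have hp := hHpos l h1
      have hb : 0 < hbar β ε l := by
        rw [← ax_hbar_zero β ε]; exact ax_hbar_strictMono β ε hβ hε hl
      have hd : h₀ - hbar β ε l = axH β (s l) := by rw [← h2]; simp [hG]
      refine ⟨hb, by linarith, ?_⟩
      rw [hd]
      obtain ⟨e, p⟩ := hmCW _ hp
      exact ax_cw_unique hβ hp.le p (hspos l h1) e (hHeq l h1)
  have F3 : StrictMonoOn G (Set.Ioo lm (β * ε)) := by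
    intro x hx y hy hxy
    have h1 := ax_hbar_strictMono β ε hβ hε hxy
    have h2 : axH β (s x) ≤ axH β (s y) := by
      by_contra hc
      push Not at hc
      have := ax_cw_mono hβ (hHpos y hy).le hc.le (hspos y hy) (hspos x hx) (hHeq y hy) (hHeq x hx)
      linarith [hsmono hxy]
    simp only [hG]; linarith
  have F3a : ∀ l ∈ Set.Ioo lm (β * ε), G l ∈ Set.Ioi (hbar β ε lm) := fun l hl => by
    have h1 := ax_hbar_strictMono β ε hβ hε hl.1
    have h2 := hHpos l hl
    simp only [hG, Set.mem_Ioi]; linarith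
  have ha0 : 0 ≤ hbar β ε lm := by
    rw [← ax_hbar_zero β ε]; exact (ax_hbar_strictMono β ε hβ hε).monotone hlm0
  have F4 : ∀ h₀ ∈ Set.Ioi (hbar β ε lm), ∃ l, l ∈ Set.Ioo lm (β * ε) ∧ G l = h₀ := by
    intro h₀ hh
    rw [Set.mem_Ioi] at hh
    set t := Real.tanh (β * (h₀ + 1 + m0)) with ht
    have ht1 : t < 1 := (ax_tanh_bd _).2
    have htm : m0 < t := by
      rw [hm0]
      apply ax_tanh_strictMono
      apply mul_lt_mul_of_pos_left _ hβ
      linarith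
    have hHt : h₀ < axH β t := by
      have : axH β t = h₀ + 1 + m0 - t := by
        unfold axH; rw [ht, Real.artanh_tanh]; field_simp
      linarith
    set l' := 1 / 2 * Real.arsinh (Real.sinh (2 * β * ε) * t) with hl'
    have hsl' : s l' = t := by
      simp only [hs, hl']
      rw [show 2 * (1 / 2 * Real.arsinh (Real.sinh (2 * β * ε) * t))
        = Real.arsinh (Real.sinh (2 * β * ε) * t) by ring, Real.sinh_arsinh]
      field_simp
    have hlr : l' ∈ Set.Ioo lm (β * ε) := (hrange l').2 (by rw [hsl']; exact ⟨htm, ht1⟩)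
    have hGc : ContinuousOn G (Set.Icc lm l') := by
      apply (ax_hbar_cont β ε).continuousOn.add
      apply (axH_cont β m0 t hm0n ht1).comp hscont.continuousOn
      intro x hx
      rw [← hslm, ← hsl']
      exact ⟨hsmono.monotone hx.1, hsmono.monotone hx.2⟩
    have hGlm : G lm = hbar β ε lm := by simp only [hG, hslm, hH0, add_zero]
    have hGl' : h₀ < G l' := by
      have : 0 ≤ hbar β ε l' := ha0.trans ((ax_hbar_strictMono β ε hβ hε).monotone hlr.1.le)
      simp only [hG, hsl']; linarith
    obtain ⟨l, hl, hle⟩ := intermediate_value_Icc hlr.1.le hGc (show h₀ ∈ Set.Icc (G lm) (G l') from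
      ⟨by rw [hGlm]; exact hh.le, hGl'.le⟩)
    refine ⟨l, ⟨lt_of_le_of_ne hl.1 ?_, hl.2.trans_lt hlr.2⟩, hle⟩
    rintro rfl
    rw [hGlm] at hle
    linarith
  choose! lf hlf hGlf using F4
  have hinj : ∀ l ∈ Set.Ioo lm (β * ε), lf (G l) = l := fun l hl =>
    F3.injOn (hlf _ (F3a l hl)) hl (hGlf _ (F3a l hl))
  have hmono : StrictMonoOn lf (Set.Ioi (hbar β ε lm)) := by
    intro x hx y hy hxy
    by_contra hc
    push Not at hc
    have := F3.monotoneOn (hlf y hy) (hlf x hx) hc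
    rw [hGlf y hy, hGlf x hx] at this
    linarith
  have hbij : Set.BijOn lf (Set.Ioi (hbar β ε lm)) (Set.Ioo lm (β * ε)) :=
    ⟨hlf, hmono.injOn, fun l hl => ⟨G l, F3a l hl, hinj l hl⟩⟩
  refine ⟨lf, ?_, hmono, hbij, ?_⟩
  · intro x hx
    refine (hmono.continuousAt_of_image_mem_nhds (Ioi_mem_nhds hx) ?_).continuousWithinAt
    rw [hbij.image_eq]
    exact Ioo_mem_nhds (hlf x hx).1 (hlf x hx).2
  · ext ⟨h₀, lam⟩
    simp only [Set.mem_ofPred_eq, Set.mem_image, Prod.mk.injEq]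
    constructor
    · rintro ⟨h1, h2⟩
      rw [← neg_neg lam, F2 h₀ (-lam) h1] at h2
      refine ⟨h₀, h2.2 ▸ F3a _ h2.1, rfl, ?_⟩
      rw [← h2.2, hinj _ h2.1, neg_neg]
    · rintro ⟨x, hx, rfl, rfl⟩
      have hp : 0 < lf x := hlm0.trans_lt (hlf x hx).1
      refine ⟨by simpa using hp, (F2 x (lf x) hp).2 ⟨hlf x hx, hGlf x hx⟩⟩
end
end

section
/- For every N∈ℕ, β,ε>0, h₀,λ∈ℝ and every pair (σ,η)∈{-1,1}^N×{-1,1}^N, the Morita approximant measure admits the integral representation K̂_{λ;β,ε,h₀,N}(σ,η) = ( ∫_ℝ exp(−βN·Φ̂_{λ;β,ε,h₀}(m))·∏_{i=1}^N π_{λ;β,ε,h₀}[m](σ_i,η_i) dm ) / ( ∫_ℝ exp(−βN·Φ̂_{λ;β,ε,h₀}(m̃)) dm̃ ), where Φ̂_{λ;β,ε,h₀}(m) = m²/2 − (1/β)·log( Σ_{k=±1} cosh(β(m+εk+h₀))·e^{λk} ). -/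
open Real Filter MeasureTheory
open scoped Classical BigOperators

noncomputable section

/-- The Morita free-energy function `Φ̂_{λ;β,ε,h₀}`. -/
def PhiHat (β ε h₀ lam m : ℝ) : ℝ :=
  m ^ 2 / 2 - 1 / β * Real.log
    (Real.cosh (β * (m + ε + h₀)) * Real.exp lam
      + Real.cosh (β * (m - ε + h₀)) * Real.exp (-lam))

lemma morG_pos (β ε h₀ lam m : ℝ) :
    0 < Real.cosh (β * (m + ε + h₀)) * Real.exp lam
      + Real.cosh (β * (m - ε + h₀)) * Real.exp (-lam) := by
  have := Real.cosh_pos (β * (m + ε + h₀))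
  have := Real.cosh_pos (β * (m - ε + h₀))
  positivity

lemma piK_sum (β ε h₀ lam m : ℝ) :
    ∑ s : Bool, ∑ t : Bool, piK β ε h₀ lam m s t = 1 := by
  have h := morG_pos β ε h₀ lam m
  simp only [Fintype.sum_bool, piK, ← add_div]
  rw [div_eq_one_iff_eq (by positivity)]
  simp only [spin, Real.cosh_eq, if_true, Bool.false_eq_true, if_false, Real.exp_add]
  ring_nf

lemma piK_prod_sum (N : ℕ) (β ε h₀ lam m : ℝ) :
    ∑ σ : Fin N → Bool, ∑ η : Fin N → Bool, ∏ i, piK β ε h₀ lam m (σ i) (η i) = 1 := by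
  have h1 : ∀ σ : Fin N → Bool, ∑ η : Fin N → Bool, ∏ i, piK β ε h₀ lam m (σ i) (η i)
      = ∏ i, ∑ t : Bool, piK β ε h₀ lam m (σ i) t := by
    intro σ
    rw [Finset.prod_univ_sum, Fintype.piFinset_univ]
  simp_rw [h1]
  have h2 := Finset.prod_univ_sum (fun _ : Fin N => (Finset.univ : Finset Bool))
    (fun _ s => ∑ t : Bool, piK β ε h₀ lam m s t)
  rw [Fintype.piFinset_univ] at h2
  rw [← h2]
  simp only [piK_sum, Finset.prod_const_one]

lemma mor_pointwise (N : ℕ) (hN : 0 < N) (β ε h₀ lam : ℝ) (hβ : 0 < β)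
    (σ η : Fin N → Bool) (m : ℝ) :
    Real.exp (-(β * N) * PhiHat β ε h₀ lam m) * ∏ i, piK β ε h₀ lam m (σ i) (η i)
      = ((2 : ℝ) ^ N)⁻¹ * Real.exp (morH N β ε h₀ lam σ η)
        * Real.exp (-(β * N / 2) * (m - (∑ i, spin (σ i)) / N) ^ 2) := by
  have hG := morG_pos β ε h₀ lam m
  have hN' : (N : ℝ) ≠ 0 := by positivity
  simp only [piK, PhiHat, Finset.prod_div_distrib, Finset.prod_const, Finset.card_univ,
    Fintype.card_fin]
  set G := Real.cosh (β * (m + ε + h₀)) * Real.exp lam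
      + Real.cosh (β * (m - ε + h₀)) * Real.exp (-lam) with hGdef
  have e1 : Real.exp (-(β * N) * (m ^ 2 / 2 - 1 / β * Real.log G))
      = Real.exp (-(β * N / 2) * m ^ 2) * G ^ N := by
    have : -(β * N) * (m ^ 2 / 2 - 1 / β * Real.log G)
        = -(β * N / 2) * m ^ 2 + N * Real.log G := by
      field_simp
      ring
    rw [this, Real.exp_add, Real.exp_nat_mul, Real.exp_log hG]
  have e2 : ∑ i, (β * (m + ε * spin (η i) + h₀) * spin (σ i) + lam * spin (η i))
      = β * m * ∑ i, spin (σ i) + β * ∑ i, (ε * spin (η i) + h₀) * spin (σ i)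
        + lam * ∑ i, spin (η i) := by
    simp only [Finset.mul_sum, ← Finset.sum_add_distrib]
    refine Finset.sum_congr rfl fun i _ => ?_
    ring
  rw [e1, ← Real.exp_sum, e2, mul_pow]
  have e3 : ∀ A B : ℝ, A * G ^ N * (B / (2 ^ N * G ^ N)) = ((2 : ℝ) ^ N)⁻¹ * (A * B) := by
    intro A B
    field_simp
  rw [e3, mul_assoc ((2 : ℝ) ^ N)⁻¹, ← Real.exp_add, ← Real.exp_add, morH]
  congr 2
  field_simp
  ring

lemma mor_integrable (N : ℕ) (hN : 0 < N) (β ε h₀ lam : ℝ) (hβ : 0 < β)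
    (σ η : Fin N → Bool) :
    Integrable (fun m : ℝ => Real.exp (-(β * N) * PhiHat β ε h₀ lam m)
      * ∏ i, piK β ε h₀ lam m (σ i) (η i)) := by
  simp_rw [mor_pointwise N hN β ε h₀ lam hβ σ η]
  have hb : 0 < β * N / 2 := by positivity
  exact ((integrable_exp_neg_mul_sq hb).comp_sub_right ((∑ i, spin (σ i)) / N)).const_mul _

lemma mor_integral (N : ℕ) (hN : 0 < N) (β ε h₀ lam : ℝ) (hβ : 0 < β)
    (σ η : Fin N → Bool) :
    ∫ m : ℝ, Real.exp (-(β * N) * PhiHat β ε h₀ lam m)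
      * ∏ i, piK β ε h₀ lam m (σ i) (η i)
      = (((2 : ℝ) ^ N)⁻¹ * √(π / (β * N / 2))) * Real.exp (morH N β ε h₀ lam σ η) := by
  simp_rw [mor_pointwise N hN β ε h₀ lam hβ σ η]
  rw [integral_const_mul,
    integral_sub_right_eq_self (fun x : ℝ => Real.exp (-(β * N / 2) * x ^ 2)),
    integral_gaussian]
  ring

lemma mor_denominator (N : ℕ) (hN : 0 < N) (β ε h₀ lam : ℝ) (hβ : 0 < β) :
    ∫ m : ℝ, Real.exp (-(β * N) * PhiHat β ε h₀ lam m)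
      = (((2 : ℝ) ^ N)⁻¹ * √(π / (β * N / 2))) * morZ N β ε h₀ lam := by
  have h : ∀ m : ℝ, Real.exp (-(β * N) * PhiHat β ε h₀ lam m)
      = ∑ σ : Fin N → Bool, ∑ η : Fin N → Bool, Real.exp (-(β * N) * PhiHat β ε h₀ lam m)
      * ∏ i, piK β ε h₀ lam m (σ i) (η i) := by
    intro m
    simp only [← Finset.mul_sum]
    rw [piK_prod_sum, mul_one]
  rw [integral_congr_ae (Eventually.of_forall h), integral_finsetSum]
  · rw [morZ, Finset.mul_sum]
    refine Finset.sum_congr rfl fun σ _ => ?_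
    rw [integral_finsetSum _ fun η _ => mor_integrable N hN β ε h₀ lam hβ σ η, Finset.mul_sum]
    exact Finset.sum_congr rfl fun η _ => mor_integral N hN β ε h₀ lam hβ σ η
  · intro σ _
    exact integrable_finsetSum _ fun η _ => mor_integrable N hN β ε h₀ lam hβ σ η

/-- Hubbard–Stratonovich integral representation of the Morita
approximant measure. -/
theorem stmt6 (N : ℕ) (hN : 0 < N) (β ε h₀ lam : ℝ) (hβ : 0 < β) (hε : 0 < ε)
    (σ η : Fin N → Bool) :
    morK N β ε h₀ lam σ η =
      (∫ m : ℝ, Real.exp (-(β * N) * PhiHat β ε h₀ lam m)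
          * ∏ i, piK β ε h₀ lam m (σ i) (η i)) /
      (∫ m : ℝ, Real.exp (-(β * N) * PhiHat β ε h₀ lam m)) := by
  rw [mor_integral N hN β ε h₀ lam hβ, mor_denominator N hN β ε h₀ lam hβ, morK,
    mul_div_mul_left]
  positivity
end
end

section
/- For all β,ε>0 and all m,h₀,λ∈ℝ, one has Σ_{k=±1} cosh(β(m+εk+h₀))·e^{λk} = 2·√(cosh(λ+βε)·cosh(λ−βε))·cosh(β(m+h₀+h̄_{β,ε}(λ))). In particular, Φ̂_{λ;β,ε,h₀}(m) := m²/2 − (1/β)·log( Σ_{k=±1} cosh(β(m+εk+h₀))·e^{λk} ) equals m²/2 − (1/β)·log cosh(β(m+ĥ)) plus a constant depending only on β,ε,λ (not on m or h₀), where ĥ = h₀ + h̄_{β,ε}(λ). -/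
open Real Filter

noncomputable section

theorem key_aux (β ε : ℝ) (hβ : 0 < β) (m h₀ lam : ℝ) :
    Real.cosh (β * (m + ε + h₀)) * Real.exp lam
        + Real.cosh (β * (m - ε + h₀)) * Real.exp (-lam)
      = 2 * Real.sqrt (Real.cosh (lam + β * ε) * Real.cosh (lam - β * ε))
          * Real.cosh (β * (m + h₀ + hbar β ε lam)) := by
  have hA := Real.cosh_pos (lam + β * ε)
  have hB := Real.cosh_pos (lam - β * ε)
  have hL : Real.cosh (β * (m + ε + h₀)) * Real.exp lam
        + Real.cosh (β * (m - ε + h₀)) * Real.exp (-lam)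
      = Real.exp (β * (m + h₀)) * Real.cosh (lam + β * ε)
        + Real.exp (-(β * (m + h₀))) * Real.cosh (lam - β * ε) := by
    simp only [Real.cosh_eq]
    ring_nf
    simp only [← Real.exp_add]
    ring_nf
  rw [hL]
  unfold hbar
  generalize Real.cosh (lam + β * ε) = A at *
  generalize Real.cosh (lam - β * ε) = B at *
  obtain ⟨a, rfl⟩ : ∃ a, A = Real.exp a := ⟨Real.log A, (Real.exp_log hA).symm⟩
  obtain ⟨b, rfl⟩ : ∃ b, B = Real.exp b := ⟨Real.log B, (Real.exp_log hB).symm⟩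
  have hs : Real.sqrt (Real.exp a * Real.exp b) = Real.exp ((a + b) / 2) := by
    rw [← Real.exp_add, Real.exp_half]
  have hx : β * (m + h₀ + 1 / (2 * β) * Real.log (Real.exp a / Real.exp b))
      = β * (m + h₀) + (a - b) / 2 := by
    rw [← Real.exp_sub, Real.log_exp]
    field_simp
  rw [hs, hx, Real.cosh_eq]
  have e1 : Real.exp (β * (m + h₀)) * Real.exp a
      = Real.exp ((a + b) / 2) * Real.exp (β * (m + h₀) + (a - b) / 2) := by
    rw [← Real.exp_add, ← Real.exp_add]; ring_nf
  have e2 : Real.exp (-(β * (m + h₀))) * Real.exp b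
      = Real.exp ((a + b) / 2) * Real.exp (-(β * (m + h₀) + (a - b) / 2)) := by
    rw [← Real.exp_add, ← Real.exp_add]; ring_nf
  rw [e1, e2]
  ring

/-- The two-term cosh sum factorizes through the effective field
`ĥ = h₀ + h̄_{β,ε}(λ)`, and hence `Φ̂` equals the Curie–Weiss free energy in field `ĥ`
up to a constant depending only on `β, ε, λ`. -/
theorem stmt7 (β ε : ℝ) (hβ : 0 < β) (hε : 0 < ε) (m h₀ lam : ℝ) :
    (Real.cosh (β * (m + ε + h₀)) * Real.exp lam
        + Real.cosh (β * (m - ε + h₀)) * Real.exp (-lam)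
      = 2 * Real.sqrt (Real.cosh (lam + β * ε) * Real.cosh (lam - β * ε))
          * Real.cosh (β * (m + h₀ + hbar β ε lam))) ∧
    ∃ C : ℝ, ∀ m' h₀' : ℝ,
      PhiHat β ε h₀' lam m'
        = m' ^ 2 / 2 - 1 / β * Real.log (Real.cosh (β * (m' + (h₀' + hbar β ε lam)))) + C := by
  refine ⟨key_aux β ε hβ m h₀ lam, -(1 / β * Real.log
    (2 * Real.sqrt (Real.cosh (lam + β * ε) * Real.cosh (lam - β * ε)))), ?_⟩
  intro m' h₀'
  have hA := Real.cosh_pos (lam + β * ε)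
  have hB := Real.cosh_pos (lam - β * ε)
  unfold PhiHat
  rw [key_aux β ε hβ m' h₀' lam, Real.log_mul (by positivity) (Real.cosh_pos _).ne', add_assoc m']
  ring
end
end

section
/- For every N∈ℕ, β,ε>0, h₀,λ∈ℝ and every σ∈{-1,1}^N, the σ-marginal of the Morita approximant measure is a Curie–Weiss Ising measure in the effective field ĥ = h₀ + h̄_{β,ε}(λ): Σ_{η∈{-1,1}^N} K̂_{λ;β,ε,h₀,N}(σ,η) = exp( (β/(2N))(Σ_{i=1}^N σ_i)² + βĥ·Σ_{i=1}^N σ_i ) / Σ_{σ'∈{-1,1}^N} exp( (β/(2N))(Σ_{i=1}^N σ'_i)² + βĥ·Σ_{i=1}^N σ'_i ). -/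
open Real Filter MeasureTheory
open scoped Classical BigOperators

noncomputable section

/-- Single-site sum over the random field. -/
lemma site_sum (β ε lam : ℝ) (hβ : 0 < β) (s : Bool) :
    ∑ t : Bool, Real.exp (β * ε * spin t * spin s + lam * spin t) =
      2 * Real.exp ((Real.log (Real.cosh (lam + β * ε))
        + Real.log (Real.cosh (lam - β * ε))) / 2) * Real.exp (β * hbar β ε lam * spin s) := by
  have ha := Real.cosh_pos (lam + β * ε)
  have hb := Real.cosh_pos (lam - β * ε)
  have hh : β * hbar β ε lam = (Real.log (Real.cosh (lam + β * ε))
        - Real.log (Real.cosh (lam - β * ε))) / 2 := by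
    unfold hbar
    rw [Real.log_div ha.ne' hb.ne']
    field_simp
  rw [hh, mul_assoc, ← Real.exp_add]
  cases s
  · have e : (Real.log (Real.cosh (lam + β * ε)) + Real.log (Real.cosh (lam - β * ε))) / 2
        + (Real.log (Real.cosh (lam + β * ε)) - Real.log (Real.cosh (lam - β * ε))) / 2
          * spin false = Real.log (Real.cosh (lam - β * ε)) := by
      simp only [spin]; norm_num; ring
    rw [e, Real.exp_log hb, Real.cosh_eq]
    simp [spin]
    ring_nf
  · have e : (Real.log (Real.cosh (lam + β * ε)) + Real.log (Real.cosh (lam - β * ε))) / 2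
        + (Real.log (Real.cosh (lam + β * ε)) - Real.log (Real.cosh (lam - β * ε))) / 2
          * spin true = Real.log (Real.cosh (lam + β * ε)) := by
      simp only [spin]; norm_num; ring
    rw [e, Real.exp_log ha, Real.cosh_eq]
    simp [spin]
    ring_nf

/-- Summing out the random fields. -/
lemma eta_sum (N : ℕ) (β ε h₀ lam : ℝ) (hβ : 0 < β) (σ : Fin N → Bool) :
    ∑ η : Fin N → Bool, Real.exp (morH N β ε h₀ lam σ η) =
      (2 * Real.exp ((Real.log (Real.cosh (lam + β * ε))
        + Real.log (Real.cosh (lam - β * ε))) / 2)) ^ N *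
      Real.exp (β / (2 * N) * (∑ i, spin (σ i)) ^ 2
          + β * (h₀ + hbar β ε lam) * ∑ i, spin (σ i)) := by
  have h1 : ∀ η : Fin N → Bool, Real.exp (morH N β ε h₀ lam σ η) =
      Real.exp (β / (2 * N) * (∑ i, spin (σ i)) ^ 2 + β * h₀ * ∑ i, spin (σ i)) *
        ∏ i, Real.exp (β * ε * spin (η i) * spin (σ i) + lam * spin (η i)) := by
    intro η
    rw [← Real.exp_sum, ← Real.exp_add]
    congr 1
    unfold morH
    rw [add_assoc, add_assoc]
    congr 1
    simp only [Finset.mul_sum, ← Finset.sum_add_distrib]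
    refine Finset.sum_congr rfl fun i _ => ?_
    ring
  have h2 : ∑ η : Fin N → Bool,
      ∏ i, Real.exp (β * ε * spin (η i) * spin (σ i) + lam * spin (η i)) =
      ∏ i, ∑ t : Bool, Real.exp (β * ε * spin t * spin (σ i) + lam * spin t) := by
    rw [Finset.prod_univ_sum, Fintype.piFinset_univ]
  simp_rw [h1]
  rw [← Finset.mul_sum, h2]
  simp_rw [site_sum β ε lam hβ]
  rw [Finset.prod_mul_distrib, Finset.prod_const, Finset.card_univ, Fintype.card_fin,
    ← Real.exp_sum, ← Finset.mul_sum, mul_left_comm, ← Real.exp_add]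
  congr 2
  ring

/-- The σ-marginal of the Morita approximant measure is a Curie–Weiss
Ising measure in the effective field `ĥ = h₀ + h̄_{β,ε}(λ)`. -/
theorem stmt9 (N : ℕ) (β ε h₀ lam : ℝ) (hβ : 0 < β) (hε : 0 < ε)
    (σ : Fin N → Bool) :
    ∑ η : Fin N → Bool, morK N β ε h₀ lam σ η =
      Real.exp (β / (2 * N) * (∑ i, spin (σ i)) ^ 2
          + β * (h₀ + hbar β ε lam) * ∑ i, spin (σ i)) /
      ∑ σ' : Fin N → Bool,
        Real.exp (β / (2 * N) * (∑ i, spin (σ' i)) ^ 2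
          + β * (h₀ + hbar β ε lam) * ∑ i, spin (σ' i)) := by
  unfold morK morZ
  rw [← Finset.sum_div]
  simp_rw [eta_sum N β ε h₀ lam hβ]
  rw [← Finset.mul_sum, mul_div_mul_left]
  positivity
end
end

section
/- Let β,ε>0 and let (m,λ)∈ℝ² satisfy the two naive Morita mean-field equations: m = ( Σ_{k=±1} sinh(β(m+εk))·e^{λk} ) / ( Σ_{k=±1} cosh(β(m+εk))·e^{λk} ) and e^{−2λ} = cosh(β(m+ε))/cosh(β(m−ε)). Then m satisfies the correct quenched mean-field equation of the random field Curie–Weiss model: m = (1/2)·( tanh(β(m+ε)) + tanh(β(m−ε)) ). -/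
open Real Filter

/-- A solution `(m, λ)` of the two naive Morita mean-field equations
satisfies the correct quenched mean-field equation of the random field
Curie–Weiss model. -/
theorem stmt11 (β ε m lam : ℝ) (hβ : 0 < β) (hε : 0 < ε)
    (h1 : m = (Real.sinh (β * (m + ε)) * Real.exp lam
              + Real.sinh (β * (m - ε)) * Real.exp (-lam)) /
            (Real.cosh (β * (m + ε)) * Real.exp lam
              + Real.cosh (β * (m - ε)) * Real.exp (-lam)))
    (h2 : Real.exp (-2 * lam) = Real.cosh (β * (m + ε)) / Real.cosh (β * (m - ε))) :
    m = 1 / 2 * (Real.tanh (β * (m + ε)) + Real.tanh (β * (m - ε))) := by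
  have e : Real.exp (-lam) =
      Real.cosh (β * (m + ε)) / Real.cosh (β * (m - ε)) * Real.exp lam := by
    rw [← h2, ← Real.exp_add]
    congr 1
    ring
  refine h1.trans ?_
  rw [e, Real.tanh_eq_sinh_div_cosh, Real.tanh_eq_sinh_div_cosh]
  have ha := Real.cosh_pos (β * (m + ε))
  have hb := Real.cosh_pos (β * (m - ε))
  have hc := Real.exp_pos lam
  clear h1 h2 e
  generalize Real.cosh (β * (m + ε)) = a at *
  generalize Real.cosh (β * (m - ε)) = b at *
  generalize Real.exp lam = c at *
  have hd : a * c + b * (a / b * c) = 2 * (a * c) := by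
    field_simp
    ring
  rw [hd]
  field_simp
end

section
/- Let β>0 and h>0, and define Φ(m) = m²/2 − (1/β)·log cosh(β(m+h)) for m∈ℝ. Then Φ attains its global minimum over ℝ, and every global minimizer of Φ is strictly positive; moreover for β>1 and h>0 the global minimizer is unique. -/
open Real Filter

lemma aux_tanh_deriv (x : ℝ) : HasDerivAt Real.tanh (1 / Real.cosh x ^ 2) x := by
  have h := (Real.hasDerivAt_sinh x).div (Real.hasDerivAt_cosh x) (Real.cosh_pos x).ne'
  have e : Real.tanh = Real.sinh / Real.cosh := by
    funext y
    simp [Real.tanh_eq_sinh_div_cosh]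
  rw [e]
  refine h.congr_deriv ?_
  have h2 := Real.cosh_sq x
  have h3 : Real.cosh x * Real.cosh x - Real.sinh x * Real.sinh x = 1 := by nlinarith
  rw [h3]

lemma aux_tanh_concave : StrictConcaveOn ℝ (Set.Ici 0) Real.tanh := by
  apply StrictAntiOn.strictConcaveOn_of_deriv (convex_Ici 0)
  · exact fun x _ => (aux_tanh_deriv x).continuousAt.continuousWithinAt
  · intro x hx y hy hxy
    rw [interior_Ici] at hx hy
    rw [(aux_tanh_deriv x).deriv, (aux_tanh_deriv y).deriv]
    have h1 : Real.cosh x < Real.cosh y :=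
      Real.cosh_strictMonoOn (Set.mem_Ici.2 (le_of_lt hx)) (Set.mem_Ici.2 (le_of_lt hy)) hxy
    have h2 := Real.cosh_pos x
    apply one_div_lt_one_div_of_lt (by positivity)
    gcongr

lemma aux_phi_deriv (β h : ℝ) (hβ : 0 < β) (m : ℝ) :
    HasDerivAt (fun m : ℝ => m ^ 2 / 2 - 1 / β * Real.log (Real.cosh (β * (m + h))))
      (m - Real.tanh (β * (m + h))) m := by
  have h1 : HasDerivAt (fun m : ℝ => β * (m + h)) β m := by
    simpa using ((hasDerivAt_id m).add_const h).const_mul β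
  have h2 := ((h1.cosh).log (Real.cosh_pos _).ne').const_mul (1 / β)
  have h3 := (((hasDerivAt_id m).pow 2).div_const 2).sub h2
  refine HasDerivAt.congr_deriv (f' := _) h3 ?_
  rw [Real.tanh_eq_sinh_div_cosh]
  have := (Real.cosh_pos (β * (m + h))).ne'
  simp
  field_simp

lemma aux_crit (β h : ℝ) (hβ : 0 < β) (m₀ : ℝ) (hm : ∀ m : ℝ,
        m₀ ^ 2 / 2 - 1 / β * Real.log (Real.cosh (β * (m₀ + h)))
          ≤ m ^ 2 / 2 - 1 / β * Real.log (Real.cosh (β * (m + h)))) :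
    Real.tanh (β * (m₀ + h)) = m₀ := by
  have hl : IsLocalMin (fun m : ℝ => m ^ 2 / 2 - 1 / β * Real.log (Real.cosh (β * (m + h)))) m₀ :=
    Filter.Eventually.of_forall hm
  linarith [hl.hasDerivAt_eq_zero (aux_phi_deriv β h hβ m₀)]

lemma aux_tanh_pos (x : ℝ) (hx : 0 < x) : 0 < Real.tanh x := by
  rw [Real.tanh_eq_sinh_div_cosh]
  exact div_pos (Real.sinh_pos_iff.2 hx) (Real.cosh_pos x)

lemma aux_pos (β h : ℝ) (hβ : 0 < β) (hh : 0 < h) (m₀ : ℝ) (hm : ∀ m : ℝ,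
        m₀ ^ 2 / 2 - 1 / β * Real.log (Real.cosh (β * (m₀ + h)))
          ≤ m ^ 2 / 2 - 1 / β * Real.log (Real.cosh (β * (m + h)))) : 0 < m₀ := by
  by_contra hn
  rcases lt_or_eq_of_le (not_lt.1 hn) with h0 | h0
  · have h1 := hm (-m₀)
    have h2 : Real.cosh (β * (m₀ + h)) < Real.cosh (β * (-m₀ + h)) := by
      rw [Real.cosh_lt_cosh, abs_mul, abs_mul]
      apply mul_lt_mul_of_pos_left _ (abs_pos.2 hβ.ne')
      rw [abs_of_pos (by linarith : 0 < -m₀ + h), abs_lt]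
      constructor <;> linarith
    have h3 := Real.log_lt_log (Real.cosh_pos _) h2
    have h4 := mul_lt_mul_of_pos_left h3 (one_div_pos.2 hβ)
    rw [neg_sq] at h1
    linarith
  · have h1 := aux_crit β h hβ m₀ hm
    have h2 := aux_tanh_pos (β * h) (by positivity)
    rw [h0, zero_add] at h1
    linarith

lemma aux_uniq (β h : ℝ) (hβ : 0 < β) (hh : 0 < h) (a b : ℝ) (ha : 0 < a) (hab : a < b)
    (h1 : Real.tanh (β * (a + h)) = a) (h2 : Real.tanh (β * (b + h)) = b) : False := by
  have hb : 0 < b := ha.trans hab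
  have h3 := aux_tanh_pos (β * h) (by positivity)
  have hx : (0 : ℝ) ≤ β * h := by positivity
  have hy : (0 : ℝ) ≤ β * (b + h) := by positivity
  have hne : β * h ≠ β * (b + h) := by
    have : 0 < β * b := by positivity
    intro h
    linarith
  have hc : 0 < 1 - a / b := by
    rw [sub_pos, div_lt_one hb]
    exact hab
  have key := aux_tanh_concave.2 hx hy hne hc (div_pos ha hb) (by ring)
  have e : (1 - a / b) • (β * h) + (a / b) • (β * (b + h)) = β * (a + h) := by
    simp only [smul_eq_mul]
    field_simp
    ring
  rw [e, h1, h2] at key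
  simp only [smul_eq_mul] at key
  rw [div_mul_cancel₀ a hb.ne'] at key
  have := mul_pos hc h3
  linarith

lemma aux_exists (β h : ℝ) (hβ : 0 < β) (hh : 0 < h) : ∃ m₀ : ℝ, ∀ m : ℝ,
        m₀ ^ 2 / 2 - 1 / β * Real.log (Real.cosh (β * (m₀ + h)))
          ≤ m ^ 2 / 2 - 1 / β * Real.log (Real.cosh (β * (m + h))) := by
  have hc : Continuous
      (fun m : ℝ => m ^ 2 / 2 - 1 / β * Real.log (Real.cosh (β * (m + h)))) :=
    continuous_iff_continuousAt.2 fun m => (aux_phi_deriv β h hβ m).continuousAt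
  apply hc.exists_forall_le' 0
  have hcc : (Metric.closedBall (0 : ℝ) (2 + 2 * h))ᶜ ∈ Filter.cocompact ℝ :=
    (isCompact_closedBall _ _).compl_mem_cocompact
  filter_upwards [hcc] with m hm
  have hm' : 2 + 2 * h < |m| := by simpa using hm
  have h0 : 0 ≤ 1 / β * Real.log (Real.cosh (β * (0 + h))) :=
    mul_nonneg (by positivity) (Real.log_nonneg (Real.one_le_cosh _))
  have h1 : Real.log (Real.cosh (β * (m + h))) ≤ |β * (m + h)| := by
    rw [Real.log_le_iff_le_exp (Real.cosh_pos _), ← Real.cosh_abs, Real.cosh_eq]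
    have : Real.exp (-|β * (m + h)|) ≤ Real.exp |β * (m + h)| :=
      Real.exp_le_exp.2 (by linarith [abs_nonneg (β * (m + h))])
    linarith
  have h2 : 1 / β * Real.log (Real.cosh (β * (m + h))) ≤ |m| + h := by
    calc _ ≤ 1 / β * |β * (m + h)| := by gcongr
      _ = |m + h| := by
        rw [abs_mul, abs_of_pos hβ]
        field_simp
      _ ≤ |m| + |h| := abs_add_le _ _
      _ = |m| + h := by rw [abs_of_pos hh]
  have h3 : m ^ 2 = |m| ^ 2 := (sq_abs m).symm
  nlinarith


/-- For `β > 0` and `h > 0`, the Curie–Weiss free-energy function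
`Φ(m) = m²/2 − (1/β)·log cosh(β(m+h))` attains its global minimum, every global
minimizer is strictly positive, and for `β > 1` the global minimizer is unique. -/
theorem stmt12 (β h : ℝ) (hβ : 0 < β) (hh : 0 < h) :
    (∃ m₀ : ℝ, ∀ m : ℝ,
        m₀ ^ 2 / 2 - 1 / β * Real.log (Real.cosh (β * (m₀ + h)))
          ≤ m ^ 2 / 2 - 1 / β * Real.log (Real.cosh (β * (m + h)))) ∧
    (∀ m₀ : ℝ, (∀ m : ℝ,
        m₀ ^ 2 / 2 - 1 / β * Real.log (Real.cosh (β * (m₀ + h)))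
          ≤ m ^ 2 / 2 - 1 / β * Real.log (Real.cosh (β * (m + h)))) → 0 < m₀) ∧
    (1 < β → ∃! m₀ : ℝ, ∀ m : ℝ,
        m₀ ^ 2 / 2 - 1 / β * Real.log (Real.cosh (β * (m₀ + h)))
          ≤ m ^ 2 / 2 - 1 / β * Real.log (Real.cosh (β * (m + h)))) := by
  refine ⟨aux_exists β h hβ hh, aux_pos β h hβ hh, fun _ => ?_⟩
  obtain ⟨a, ha⟩ := aux_exists β h hβ hh
  refine ⟨a, ha, fun b hb => ?_⟩
  have pa := aux_pos β h hβ hh a ha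
  have pb := aux_pos β h hβ hh b hb
  have ca := aux_crit β h hβ a ha
  have cb := aux_crit β h hβ b hb
  rcases lt_trichotomy b a with hl | hl | hl
  · exact (aux_uniq β h hβ hh b a pb hl cb ca).elim
  · exact hl
  · exact (aux_uniq β h hβ hh a b pa hl ca cb).elim
end

section
/- Let β>1, ε>0 and λ>0, and define Φ_{λ;β,ε}(m) = m²/2 − (1/β)·log( Σ_{k=±1} cosh(β(m+εk))·e^{λk} ) for m∈ℝ. Then every global minimizer m of Φ_{λ;β,ε} is strictly positive, and no global minimizer m satisfies the neutrality equation e^{−2λ} = cosh(β(m+ε))/cosh(β(m−ε)). Hence there is no pair (m,λ) with λ>0 and m a global minimizer of Φ_{λ;β,ε} solving the naive Morita equations. -/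
open Real Filter

/-- The Morita free-energy function `Φ_{λ;β,ε}` at zero external field. -/
noncomputable def PhiMor (β ε lam m : ℝ) : ℝ :=
  m ^ 2 / 2 - 1 / β * Real.log
    (Real.cosh (β * (m + ε)) * Real.exp lam + Real.cosh (β * (m - ε)) * Real.exp (-lam))

lemma cosh_lt_aux (β ε m : ℝ) (hβ : 1 < β) (hε : 0 < ε) (hm : 0 < m) :
    Real.cosh (β * (m - ε)) < Real.cosh (β * (m + ε)) := by
  rw [Real.cosh_lt_cosh, ← sq_lt_sq]
  have h : 0 < β ^ 2 * (m * ε) := by positivity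
  nlinarith

lemma min_pos_aux (β ε lam : ℝ) (hβ : 1 < β) (hε : 0 < ε) (hlam : 0 < lam) (m : ℝ)
    (h : ∀ m' : ℝ, PhiMor β ε lam m ≤ PhiMor β ε lam m') : 0 < m := by
  have hβ0 : 0 < β := by linarith
  have hexp : Real.exp (-lam) < Real.exp lam := Real.exp_lt_exp.2 (by linarith)
  by_contra hm
  rcases lt_or_eq_of_le (not_lt.1 hm) with hm | hm
  · have h1 := h (-m)
    have hc := cosh_lt_aux β ε (-m) hβ hε (by linarith)
    have e1 : Real.cosh (β * (-m - ε)) = Real.cosh (β * (m + ε)) := by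
      rw [← Real.cosh_neg]; congr 1; ring
    have e2 : Real.cosh (β * (-m + ε)) = Real.cosh (β * (m - ε)) := by
      rw [← Real.cosh_neg]; congr 1; ring
    unfold PhiMor at h1
    rw [e1, e2] at h1
    rw [e1, e2] at hc
    have hpos : 0 < Real.cosh (β * (m + ε)) * Real.exp lam
        + Real.cosh (β * (m - ε)) * Real.exp (-lam) := by
      have := Real.cosh_pos (β * (m + ε))
      have := Real.cosh_pos (β * (m - ε))
      positivity
    have hl := Real.log_lt_log hpos (show _ < Real.cosh (β * (m - ε)) * Real.exp lam
        + Real.cosh (β * (m + ε)) * Real.exp (-lam) by nlinarith)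
    have hl2 := mul_lt_mul_of_pos_left hl (show 0 < 1 / β by positivity)
    have : (-m) ^ 2 = m ^ 2 := by ring
    rw [this] at h1
    linarith
  · subst hm
    have hmin : IsLocalMin (PhiMor β ε lam) 0 := Filter.Eventually.of_forall h
    have hpos : 0 < Real.cosh (β * ((0:ℝ) + ε)) * Real.exp lam
        + Real.cosh (β * ((0:ℝ) - ε)) * Real.exp (-lam) := by
      have := Real.cosh_pos (β * ((0:ℝ) + ε))
      have := Real.cosh_pos (β * ((0:ℝ) - ε))
      positivity
    have d1 : HasDerivAt (fun m : ℝ => β * (m + ε)) (β * 1) 0 :=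
      ((hasDerivAt_id (0:ℝ)).add_const ε).const_mul β
    have d2 : HasDerivAt (fun m : ℝ => β * (m - ε)) (β * 1) 0 :=
      ((hasDerivAt_id (0:ℝ)).sub_const ε).const_mul β
    have d3 := (((d1.cosh).mul_const (Real.exp lam)).add
      ((d2.cosh).mul_const (Real.exp (-lam)))).log hpos.ne'
    have d4 := (((hasDerivAt_id (0:ℝ)).pow 2).div_const 2).sub (d3.const_mul (1 / β))
    have hz := hmin.hasDerivAt_eq_zero (f' := _) d4
    have hs : 0 < Real.sinh (β * ε) := Real.sinh_pos_iff.2 (by positivity)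
    have e : β * (0 - ε) = -(β * ε) := by ring
    have hq : 0 < 1 / β * ((Real.sinh (β * ((0:ℝ) + ε)) * (β * 1) * Real.exp lam
        + Real.sinh (β * ((0:ℝ) - ε)) * (β * 1) * Real.exp (-lam)) /
        (Real.cosh (β * ((0:ℝ) + ε)) * Real.exp lam
        + Real.cosh (β * ((0:ℝ) - ε)) * Real.exp (-lam))) := by
      refine mul_pos (by positivity) (div_pos ?_ hpos)
      rw [e, Real.sinh_neg, zero_add]
      have := mul_pos (mul_pos hs hβ0) (sub_pos.2 hexp)
      nlinarith
    simp only [id, Pi.add_apply] at hz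
    norm_num at hz hq
    rcases hz with hz | hz | hz <;> simp_all

/-- For `β > 1`, `ε > 0`, `λ > 0`, every global minimizer of
`Φ_{λ;β,ε}` is strictly positive and fails the neutrality equation; hence no pair
`(m, λ)` with `λ > 0` and `m` a global minimizer solves the naive Morita equations. -/
theorem stmt13 (β ε lam : ℝ) (hβ : 1 < β) (hε : 0 < ε) (hlam : 0 < lam) :
    (∀ m : ℝ, (∀ m' : ℝ, PhiMor β ε lam m ≤ PhiMor β ε lam m') → 0 < m) ∧
    (∀ m : ℝ, (∀ m' : ℝ, PhiMor β ε lam m ≤ PhiMor β ε lam m') →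
      Real.exp (-2 * lam) ≠ Real.cosh (β * (m + ε)) / Real.cosh (β * (m - ε))) := by
  refine ⟨fun m h => min_pos_aux β ε lam hβ hε hlam m h, fun m h heq => ?_⟩
  have hm := min_pos_aux β ε lam hβ hε hlam m h
  have hc := cosh_lt_aux β ε m hβ hε hm
  have h1 : 1 < Real.cosh (β * (m + ε)) / Real.cosh (β * (m - ε)) :=
    (one_lt_div (Real.cosh_pos _)).2 hc
  have h2 : Real.exp (-2 * lam) < 1 := by rw [← Real.exp_zero]; exact Real.exp_lt_exp.2 (by linarith)
  linarith
end

section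
/- For every N∈ℕ with N≥2, β,ε>0, h₀∈ℝ, every (σ,η)∈{-1,1}^N×{-1,1}^N, the single-site conditional probability of the true joint measure satisfies K_{β,ε,h₀,N}(σ₁,η₁ | σ_{[2,N]}, η_{[2,N]}) = π_{λ_N(η_{[2,N]});β,ε,h₀}[ (1/N)·Σ_{i=2}^N σ_i ](σ₁,η₁), where λ_N(η_{[2,N]}) = (1/2)·log( Z_{β,ε,h₀,N}[(−1,η_{[2,N]})] / Z_{β,ε,h₀,N}[(+1,η_{[2,N]})] ). Here the conditional probability is K_{β,ε,h₀,N}(σ,η) divided by Σ_{σ₁',η₁'∈{-1,1}} K_{β,ε,h₀,N}((σ₁',σ_{[2,N]}),(η₁',η_{[2,N]})). -/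
open Real Filter
open scoped Classical BigOperators

noncomputable section

/-- Hamiltonian (with sign absorbed) of the quenched random field Curie–Weiss model. -/
def qH (N : ℕ) (β ε h₀ : ℝ) (σ η : Fin N → Bool) : ℝ :=
  β / (2 * N) * (∑ i, spin (σ i)) ^ 2 + β * ∑ i, (ε * spin (η i) + h₀) * spin (σ i)

/-- Quenched partition function `Z_{β,ε,h₀,N}[η]`. -/
def qZ (N : ℕ) (β ε h₀ : ℝ) (η : Fin N → Bool) : ℝ :=
  ∑ σ : Fin N → Bool, Real.exp (qH N β ε h₀ σ η)

/-- Quenched Gibbs measure `μ_{β,ε,h₀,N}[η](σ)`. -/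
def quenched (N : ℕ) (β ε h₀ : ℝ) (η σ : Fin N → Bool) : ℝ :=
  Real.exp (qH N β ε h₀ σ η) / qZ N β ε h₀ η

/-- True joint measure `K_{β,ε,h₀,N}(σ,η) = 2^{-N}·μ[η](σ)`. -/
def jointK (N : ℕ) (β ε h₀ : ℝ) (σ η : Fin N → Bool) : ℝ :=
  ((2 : ℝ) ^ N)⁻¹ * quenched N β ε h₀ η σ

/-- The random Morita chemical potential
`λ_N(η_{[2,N]}) = (1/2)·log(Z[(−1,η_{[2,N]})]/Z[(+1,η_{[2,N]})])`; site 1 is index `0`,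
`true` codes `+1` and `false` codes `−1`. -/
def lamN (n : ℕ) (β ε h₀ : ℝ) (ηr : Fin n → Bool) : ℝ :=
  1 / 2 * Real.log (qZ (n + 1) β ε h₀ (Fin.cons false ηr) / qZ (n + 1) β ε h₀ (Fin.cons true ηr))

theorem qZ_pos_aux (N : ℕ) (β ε h₀ : ℝ) (η : Fin N → Bool) : 0 < qZ N β ε h₀ η :=
  Finset.sum_pos (fun _ _ => Real.exp_pos _) Finset.univ_nonempty

theorem jointK_factor (n : ℕ) (β ε h₀ : ℝ) (σr ηr : Fin n → Bool) :
    ∃ c : ℝ, c ≠ 0 ∧ ∀ s t : Bool,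
      jointK (n + 1) β ε h₀ (Fin.cons s σr) (Fin.cons t ηr) =
        c * Real.exp (β * ((((n : ℝ) + 1)⁻¹ * ∑ i, spin (σr i)) + ε * spin t + h₀) * spin s
          + lamN n β ε h₀ ηr * spin t) := by
  have hp := qZ_pos_aux (n + 1) β ε h₀ (Fin.cons true ηr)
  have hm := qZ_pos_aux (n + 1) β ε h₀ (Fin.cons false ηr)
  have hl : Real.exp (lamN n β ε h₀ ηr) * Real.exp (lamN n β ε h₀ ηr) =
      qZ (n + 1) β ε h₀ (Fin.cons false ηr) / qZ (n + 1) β ε h₀ (Fin.cons true ηr) := by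
    rw [← Real.exp_add, ← Real.exp_log (div_pos hm hp)]
    congr 1
    unfold lamN
    ring
  have hn : (n : ℝ) + 1 ≠ 0 := by positivity
  have hH : ∀ s t : Bool, qH (n + 1) β ε h₀ (Fin.cons s σr) (Fin.cons t ηr) =
      (β / (2 * ((n : ℝ) + 1)) * (1 + (∑ i, spin (σr i)) ^ 2)
        + β * ∑ i, (ε * spin (ηr i) + h₀) * spin (σr i))
      + β * ((((n : ℝ) + 1)⁻¹ * ∑ i, spin (σr i)) + ε * spin t + h₀) * spin s := by
    intro s t
    have hs : spin s ^ 2 = 1 := by cases s <;> simp [spin]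
    simp only [qH, Fin.sum_univ_succ, Fin.cons_zero, Fin.cons_succ]
    push_cast
    generalize (∑ i, spin (σr i)) = S
    generalize (∑ i, (ε * spin (ηr i) + h₀) * spin (σr i)) = T
    rw [← hs]
    field_simp
    ring
  have ha := Real.exp_pos (lamN n β ε h₀ ηr)
  refine ⟨((2 : ℝ) ^ (n + 1))⁻¹ * Real.exp (β / (2 * ((n : ℝ) + 1)) * (1 + (∑ i, spin (σr i)) ^ 2)
        + β * ∑ i, (ε * spin (ηr i) + h₀) * spin (σr i)) /
        (Real.exp (lamN n β ε h₀ ηr) * qZ (n + 1) β ε h₀ (Fin.cons true ηr)), by positivity, ?_⟩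
  intro s t
  unfold jointK quenched
  rw [hH, Real.exp_add, Real.exp_add _ (lamN n β ε h₀ ηr * spin t)]
  rw [eq_div_iff hp.ne'] at hl
  cases t
  · have : Real.exp (lamN n β ε h₀ ηr * spin false) = (Real.exp (lamN n β ε h₀ ηr))⁻¹ := by
      rw [← Real.exp_neg]; simp [spin]
    rw [this, ← hl]
    field_simp
  · have : Real.exp (lamN n β ε h₀ ηr * spin true) = Real.exp (lamN n β ε h₀ ηr) := by
      simp [spin]
    rw [this]
    field_simp

/-- The single-site conditional probability of the true joint measure
(at site 1, given the configuration at sites 2,…,N with `N = n+1 ≥ 2`) is given by the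
kernel `π_{λ_N(η_{[2,N]})}[(1/N)·Σ_{i=2}^N σ_i]`. -/
theorem stmt14 (n : ℕ) (hn : 1 ≤ n) (β ε h₀ : ℝ) (hβ : 0 < β) (hε : 0 < ε)
    (s₁ t₁ : Bool) (σr ηr : Fin n → Bool) :
    jointK (n + 1) β ε h₀ (Fin.cons s₁ σr) (Fin.cons t₁ ηr) /
      (∑ s : Bool, ∑ t : Bool, jointK (n + 1) β ε h₀ (Fin.cons s σr) (Fin.cons t ηr)) =
    piK β ε h₀ (lamN n β ε h₀ ηr) (((n : ℝ) + 1)⁻¹ * ∑ i, spin (σr i)) s₁ t₁ := by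
  obtain ⟨c, hc, h⟩ := jointK_factor n β ε h₀ σr ηr
  simp only [h, ← Finset.mul_sum]
  rw [mul_div_mul_left _ _ hc]
  unfold piK
  congr 1
  generalize lamN n β ε h₀ ηr = l
  generalize ((n : ℝ) + 1)⁻¹ * ∑ i, spin (σr i) = m
  simp only [Fintype.sum_bool, Real.cosh_eq, Real.exp_add, spin, if_true, Bool.false_eq_true,
    if_false, mul_one, mul_neg, ← sub_eq_add_neg]
  ring
end
end
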